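/- Let s ∈ (0,1), β ∈ (0,1) and α ∈ (0,s) satisfying α+β < 2s. Let L be an operator of the form (1.3), and let w : (−∞,0)×ℝ^n → ℝ be such that, for every h ∈ ℝ^n and every τ < 0, the increment v(t,x) = w(t+τ,x+h) − w(t,x) satisfies ∂_t v − Lv = 0 in (−∞,0)×ℝ^n. Assume [w]_{C_{t,x}^{β/(2s),β}(Q_R)} ≤ C R^{α+s} for all R ≥ 1 and some constant C > 0. Then w(t,x) = a t + xᵀA x + p·x + q for some a, q ∈ ℝ, p ∈ ℝ^n and a symmetric n×n matrix A. Moreover, a = 0 if α+β < s, A = 0 if α+β+s < 2, and p = 0 if α+β+s < 1. -/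

import Mathlib

open Set MeasureTheory Metric Topology Filter
noncomputable section

/-- `ℝ^n` as Euclidean space. -/
abbrev En (n : ℕ) := EuclideanSpace ℝ (Fin n)

/-- The last coordinate `x_n` of a point `x ∈ ℝ^n`. -/
def lastC {n : ℕ} (x : En n) : ℝ := if h : 0 < n then x ⟨n - 1, by omega⟩ else 0

/-- The unit vector `e_n ∈ ℝ^n`. -/
def eLast (n : ℕ) : En n := if h : 0 < n then EuclideanSpace.single ⟨n - 1, by omega⟩ (1 : ℝ) else 0

/-- Ellipticity bounds `λ ≤ a ≤ Λ` on the unit sphere. -/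
def KernelBounds {n : ℕ} (lam Lam : ℝ) (a : En n → ℝ) : Prop :=
  ∀ y : En n, ‖y‖ = 1 → lam ≤ a y ∧ a y ≤ Lam

/-- `‖a‖_{C^{1,γ}(S^{n-1})} ≤ A`. -/
def SphereC1GammaBound {n : ℕ} (γ A : ℝ) (a : En n → ℝ) : Prop :=
  ∃ g : En n → (En n →L[ℝ] ℝ),
    (∀ y ∈ sphere (0 : En n) 1, HasFDerivWithinAt a (g y) (sphere (0 : En n) 1) y) ∧
    (∀ y ∈ sphere (0 : En n) 1, |a y| ≤ A ∧ ‖g y‖ ≤ A) ∧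
    (∀ y ∈ sphere (0 : En n) 1, ∀ z ∈ sphere (0 : En n) 1, ‖g y - g z‖ ≤ A * ‖y - z‖ ^ γ)

/-- The integrand of the nonlocal operator (1.3). -/
def Lintegrand (n : ℕ) (s : ℝ) (a u : En n → ℝ) (x y : En n) : ℝ :=
  (u (x + y) + u (x - y) - 2 * u x) * a (‖y‖⁻¹ • y) / ‖y‖ ^ ((n : ℝ) + 2 * s)

/-- The nonlocal operator `L` of the form (1.3). -/
def Lop (n : ℕ) (s : ℝ) (a u : En n → ℝ) (x : En n) : ℝ := ∫ y : En n, Lintegrand n s a u x y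

/-- `u` solves `∂_t u - L u = f` pointwise at `(t,x)`, the integral defining `Lu`
being absolutely convergent. -/
def SolvesAt (n : ℕ) (s : ℝ) (a : En n → ℝ) (u f : ℝ → En n → ℝ) (t : ℝ) (x : En n) : Prop :=
  Integrable (Lintegrand n s a (u t) x) ∧
  HasDerivAt (fun τ : ℝ => u τ x) (Lop n s a (u t) x + f t x) t

/-- `‖w‖_{L^∞(I×D)} ≤ M`. -/
def SupBnd {n : ℕ} (M : ℝ) (I : Set ℝ) (D : Set (En n)) (w : ℝ → En n → ℝ) : Prop :=
  ∀ t ∈ I, ∀ x ∈ D, |w t x| ≤ M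

/-- `[w]_{C_{t,x}^{θ/2s,θ}(I×D)} ≤ M`, for `θ ∈ (0,1)`. -/
def ParHolderBnd {n : ℕ} (s θ M : ℝ) (I : Set ℝ) (D : Set (En n)) (w : ℝ → En n → ℝ) : Prop :=
  ∀ t ∈ I, ∀ x ∈ D, ∀ t' ∈ I, ∀ x' ∈ D,
    |w t x - w t' x'| ≤ M * (|t - t'| ^ (θ / (2 * s)) + ‖x - x'‖ ^ θ)

/-- `[w]_{C_t^α(I×D)} ≤ M`. -/
def TimeHolderBnd {n : ℕ} (α M : ℝ) (I : Set ℝ) (D : Set (En n)) (w : ℝ → En n → ℝ) : Prop :=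
  ∀ x ∈ D, ∀ t ∈ I, ∀ t' ∈ I, |w t x - w t' x| ≤ M * |t - t'| ^ α

/-- Spatial gradient `∇_x w`. -/
def SpaceGrad {n : ℕ} (w : ℝ → En n → ℝ) (t : ℝ) (x : En n) : En n →L[ℝ] ℝ := fderiv ℝ (w t) x

/-- Spatial Hessian `D²_x w`. -/
def SpaceHess {n : ℕ} (w : ℝ → En n → ℝ) (t : ℝ) (x : En n) :
    ContinuousMultilinearMap ℝ (fun _ : Fin 2 => En n) ℝ := iteratedFDeriv ℝ 2 (w t) x

/-- Time derivative `∂_t w`. -/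
def TimeDeriv {n : ℕ} (w : ℝ → En n → ℝ) (t : ℝ) (x : En n) : ℝ := deriv (fun τ => w τ x) t

/-- `‖∇_x w‖_{L^∞(I×D)} ≤ M`. -/
def GradSupBnd {n : ℕ} (M : ℝ) (I : Set ℝ) (D : Set (En n)) (w : ℝ → En n → ℝ) : Prop :=
  ∀ t ∈ I, ∀ x ∈ D, ‖SpaceGrad w t x‖ ≤ M

/-- `[∇_x w]_{C_{t,x}^{θ/2s,θ}(I×D)} ≤ M`. -/
def GradParHolderBnd {n : ℕ} (s θ M : ℝ) (I : Set ℝ) (D : Set (En n)) (w : ℝ → En n → ℝ) : Prop :=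
  ∀ t ∈ I, ∀ x ∈ D, ∀ t' ∈ I, ∀ x' ∈ D,
    ‖SpaceGrad w t x - SpaceGrad w t' x'‖ ≤ M * (|t - t'| ^ (θ / (2 * s)) + ‖x - x'‖ ^ θ)

/-- `[∇_x w]_{C_t^α(I×D)} ≤ M`. -/
def GradTimeHolderBnd {n : ℕ} (α M : ℝ) (I : Set ℝ) (D : Set (En n)) (w : ℝ → En n → ℝ) : Prop :=
  ∀ x ∈ D, ∀ t ∈ I, ∀ t' ∈ I, ‖SpaceGrad w t x - SpaceGrad w t' x‖ ≤ M * |t - t'| ^ α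

/-- `[w]_{C_{t,x}^{θ/2s,θ}(I×D)} ≤ M`, covering both `θ ∈ (0,1)` and `θ ∈ (1,2)`. -/
def ParSemiBnd {n : ℕ} (s θ M : ℝ) (I : Set ℝ) (D : Set (En n)) (w : ℝ → En n → ℝ) : Prop :=
  (θ < 1 → ParHolderBnd s θ M I D w) ∧
  (1 < θ → TimeHolderBnd (θ / (2 * s)) M I D w ∧ GradParHolderBnd s (θ - 1) M I D w)

/-- `‖w‖_{C_{t,x}^{θ/2s,θ}(I×D)} ≤ M`, covering both `θ ∈ (0,1)` and `θ ∈ (1,2)`. -/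
def ParNormBnd {n : ℕ} (s θ M : ℝ) (I : Set ℝ) (D : Set (En n)) (w : ℝ → En n → ℝ) : Prop :=
  SupBnd M I D w ∧ (1 < θ → GradSupBnd M I D w) ∧ ParSemiBnd s θ M I D w

/-- `[w]_{C_{t,x}^{(α+β+s)/2s, α+β+s}(I×D)} ≤ M`, the higher-order parabolic seminorm
`[∂_t w]_{C^{(α+β-s)/2s, α+β-s}} + [∇_x w]_{C_t^{(α+β-s)/2s}} + [D²_x w]_{C^{(α+β-3s)/2s, α+β+s-2}}`,
each term being present when the corresponding exponent is positive. -/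
def HighSemiBnd {n : ℕ} (s α β M : ℝ) (I : Set ℝ) (D : Set (En n)) (w : ℝ → En n → ℝ) : Prop :=
  (0 < α + β - s → α + β - s < 1 → ParHolderBnd s (α + β - s) M I D (TimeDeriv w)) ∧
  (0 < α + β - s → GradTimeHolderBnd ((α + β - s) / (2 * s)) M I D w) ∧
  (0 < α + β + s - 2 → ∀ t ∈ I, ∀ x ∈ D, ∀ x' ∈ D,
      ‖SpaceHess w t x - SpaceHess w t x'‖ ≤ M * ‖x - x'‖ ^ (α + β + s - 2)) ∧
  (0 < α + β - 3 * s → ∀ x ∈ D, ∀ t ∈ I, ∀ t' ∈ I,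
      ‖SpaceHess w t x - SpaceHess w t' x‖ ≤ M * |t - t'| ^ ((α + β - 3 * s) / (2 * s)))

/-- `Γ` is a `C^{2,γ}` surface splitting `ℝ^n` into `Ω^+` and `Ω^-` with norm smaller
than 1: it is the graph `{x_n = φ(x')}` of a `C^{2,γ}` function `φ` (independent of the last
coordinate) with `C^{2,γ}` norm smaller than 1, passing through `0` with normal `e_n` there,
and `Ω^± = {±(x_n - φ) > 0}`. -/
def IsSplitSurface {n : ℕ} (γ : ℝ) (φ : En n → ℝ) (Ωp Ωm : Set (En n)) : Prop :=
  (∀ x y : En n, (∀ i : Fin n, (i : ℕ) ≠ n - 1 → x i = y i) → φ x = φ y) ∧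
  ContDiff ℝ 2 φ ∧ φ 0 = 0 ∧ fderiv ℝ φ 0 = 0 ∧
  (∃ c < (1 : ℝ),
    (∀ x, |φ x| + ‖fderiv ℝ φ x‖ + ‖iteratedFDeriv ℝ 2 φ x‖ ≤ c) ∧
    (∀ x y, ‖iteratedFDeriv ℝ 2 φ x - iteratedFDeriv ℝ 2 φ y‖ ≤ c * ‖x - y‖ ^ γ)) ∧
  Ωp = {x | φ x < lastC x} ∧ Ωm = {x | lastC x < φ x}

/-- `d` is a `C^{2,γ}(closure Ω^+)` function coinciding with `dist(·,Ω^-)` in a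
neighborhood of `Γ ∩ B_4` and vanishing outside `B_5`. -/
def IsDistLike {n : ℕ} (γ : ℝ) (Ωp Ωm : Set (En n)) (d : En n → ℝ) : Prop :=
  ContDiffOn ℝ 2 d (closure Ωp) ∧
  (∃ M : ℝ, ∀ x ∈ closure Ωp, ∀ y ∈ closure Ωp,
    ‖iteratedFDerivWithin ℝ 2 d (closure Ωp) x - iteratedFDerivWithin ℝ 2 d (closure Ωp) y‖
      ≤ M * ‖x - y‖ ^ γ) ∧
  (∃ U : Set (En n), IsOpen U ∧ frontier Ωp ∩ ball (0 : En n) 4 ⊆ U ∧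
    ∀ x ∈ U, d x = infDist x Ωm) ∧
  (∀ x : En n, x ∉ ball (0 : En n) 5 → d x = 0)

lemma aux_pow_second_diff (ε : ℝ) (h0 : 0 < ε) (h1 : ε < 1) :
    ∃ c > (0 : ℝ), ∀ q : ℝ, |q| ≤ 1 / 2 → (1 + q) ^ ε + (1 - q) ^ ε ≤ 2 - c * q ^ 2 := by
  set c : ℝ := ε * (1 - ε) * (3 / 2 : ℝ) ^ (ε - 2) / 2 with hc
  have hcpos : 0 < c := by
    have : 0 < 1 - ε := by linarith
    positivity
  refine ⟨2 * c, by positivity, fun q hq => ?_⟩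
  have hconc : ConcaveOn ℝ (Icc (1 / 2 : ℝ) (3 / 2)) (fun r : ℝ => r ^ ε + c * r ^ 2) := by
    have hd1 : ∀ r : ℝ, 0 < r → HasDerivAt (fun r : ℝ => r ^ ε + c * r ^ 2)
        (ε * r ^ (ε - 1) + 2 * c * r) r := by
      intro r hr
      have := (Real.hasDerivAt_rpow_const (p := ε) (Or.inl hr.ne')).add
        (((hasDerivAt_id r).pow 2).const_mul c)
      refine this.congr_deriv ?_
      simp; ring
    have hd2 : ∀ r : ℝ, 0 < r → HasDerivAt (fun r : ℝ => ε * r ^ (ε - 1) + 2 * c * r)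
        (ε * ((ε - 1) * r ^ (ε - 1 - 1)) + 2 * c) r := by
      intro r hr
      have := ((Real.hasDerivAt_rpow_const (p := ε - 1) (Or.inl hr.ne')).const_mul ε).add
        ((hasDerivAt_id r).const_mul (2 * c))
      refine this.congr_deriv ?_
      simp
    refine concaveOn_of_hasDerivWithinAt2_nonpos (convex_Icc _ _)
      (f' := fun r => ε * r ^ (ε - 1) + 2 * c * r)
      (f'' := fun r => ε * ((ε - 1) * r ^ (ε - 1 - 1)) + 2 * c) ?_ ?_ ?_ ?_
    · intro r hr
      exact (hd1 r (by linarith [hr.1])).continuousAt.continuousWithinAt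
    · intro r hr
      rw [interior_Icc] at hr
      exact (hd1 r (by linarith [hr.1])).hasDerivWithinAt
    · intro r hr
      rw [interior_Icc] at hr
      exact (hd2 r (by linarith [hr.1])).hasDerivWithinAt
    · intro r hr
      rw [interior_Icc] at hr
      have hle : (3 / 2 : ℝ) ^ (ε - 2) ≤ r ^ (ε - 2) :=
        Real.rpow_le_rpow_of_nonpos (by linarith [hr.1]) hr.2.le (by linarith)
      have e1 : ε - 1 - 1 = ε - 2 := by ring
      simp only [e1]
      have : 0 < ε * (1 - ε) := mul_pos h0 (by linarith)
      have := mul_le_mul_of_nonneg_left hle this.le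
      rw [hc]; linarith
  rw [abs_le] at hq
  have hm1 : 1 + q ∈ Icc (1 / 2 : ℝ) (3 / 2) := ⟨by linarith, by linarith⟩
  have hm2 : 1 - q ∈ Icc (1 / 2 : ℝ) (3 / 2) := ⟨by linarith, by linarith⟩
  have := hconc.2 hm1 hm2 (show (0 : ℝ) ≤ 1 / 2 by norm_num) (show (0 : ℝ) ≤ 1 / 2 by norm_num)
    (by norm_num)
  simp only [smul_eq_mul] at this
  have e : (1 / 2 * (1 + q) + 1 / 2 * (1 - q) : ℝ) = 1 := by ring
  rw [e, Real.one_rpow] at this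
  linarith

/-- localisation profile -/
def gfun {n : ℕ} (p : ℝ) (x : En n) : ℝ := (1 + ‖x‖ ^ 2) ^ p - 1

def mfun {n : ℕ} (p : ℝ) (y : En n) : ℝ := min (‖y‖ ^ 2) (‖y‖ ^ (2 * p))

lemma gfun_nonneg {n : ℕ} {p : ℝ} (hp : 0 < p) (x : En n) : 0 ≤ gfun p x := by
  unfold gfun
  have := Real.one_le_rpow (x := 1 + ‖x‖ ^ 2) (by nlinarith [sq_nonneg ‖x‖]) hp.le
  linarith

lemma mfun_nonneg {n : ℕ} {p : ℝ} (y : En n) : 0 ≤ mfun p y := by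
  unfold mfun; positivity

lemma gfun_le_sq {n : ℕ} {p : ℝ} (hp : 0 < p) (hp1 : p < 1) (x : En n) : gfun p x ≤ ‖x‖ ^ 2 := by
  unfold gfun
  have := Real.rpow_le_rpow_of_exponent_le (x := 1 + ‖x‖ ^ 2) (by nlinarith [sq_nonneg ‖x‖]) hp1.le
  rw [Real.rpow_one] at this
  linarith

lemma gfun_continuous {n : ℕ} {p : ℝ} (hp : 0 < p) : Continuous (gfun (n := n) p) := by
  unfold gfun
  refine Continuous.sub ?_ continuous_const
  exact Continuous.rpow_const (by fun_prop) (fun _ => Or.inr hp.le)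

lemma gfun_second_diff {n : ℕ} {p : ℝ} (hp : 0 < p) (hp1 : p < 1) (x y : En n) :
    gfun p (x + y) + gfun p (x - y) - 2 * gfun p x ≤ 2 * mfun p y := by
  unfold gfun mfun
  have hpar : ‖x + y‖ ^ 2 + ‖x - y‖ ^ 2 = 2 * ‖x‖ ^ 2 + 2 * ‖y‖ ^ 2 := by
    have := parallelogram_law_with_norm ℝ x y
    nlinarith
  have hm1 : 1 + ‖x + y‖ ^ 2 ∈ Ici (0 : ℝ) := mem_Ici.2 (by positivity)
  have hm2 : 1 + ‖x - y‖ ^ 2 ∈ Ici (0 : ℝ) := mem_Ici.2 (by positivity)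
  have hconc := (Real.concaveOn_rpow hp.le hp1.le).2 hm1 hm2
    (show (0 : ℝ) ≤ 1 / 2 by norm_num) (show (0 : ℝ) ≤ 1 / 2 by norm_num) (by norm_num)
  simp only [smul_eq_mul] at hconc
  have e : (1 / 2 * (1 + ‖x + y‖ ^ 2) + 1 / 2 * (1 + ‖x - y‖ ^ 2) : ℝ)
    = (1 + ‖x‖ ^ 2) + ‖y‖ ^ 2 := by linarith
  rw [e] at hconc
  have h1 : ((1 + ‖x‖ ^ 2) + ‖y‖ ^ 2) ^ p ≤ (1 + ‖x‖ ^ 2) ^ p + ‖y‖ ^ (2 * p) := by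
    have := Real.rpow_add_le_add_rpow (a := 1 + ‖x‖ ^ 2) (b := ‖y‖ ^ 2) (p := p)
      (by positivity) (by positivity) hp.le hp1.le
    rw [Real.rpow_mul (norm_nonneg y)]
    simpa using this
  have h2 : ((1 + ‖x‖ ^ 2) + ‖y‖ ^ 2) ^ p ≤ (1 + ‖x‖ ^ 2) ^ p + ‖y‖ ^ 2 := by
    set A := 1 + ‖x‖ ^ 2 with hA
    have hA1 : 1 ≤ A := by nlinarith [sq_nonneg ‖x‖]
    have hA0 : 0 < A := by linarith
    have e2 : A + ‖y‖ ^ 2 = A * (1 + ‖y‖ ^ 2 / A) := by field_simp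
    rw [e2, Real.mul_rpow hA0.le (by positivity)]
    have hb := rpow_one_add_le_one_add_mul_self (s := ‖y‖ ^ 2 / A) (p := p)
      (by have : 0 ≤ ‖y‖ ^ 2 / A := by positivity
          linarith) hp.le hp1.le
    have hAp : A ^ p ≤ A := by
      have := Real.rpow_le_rpow_of_exponent_le hA1 hp1.le
      rwa [Real.rpow_one] at this
    have hAp0 : 0 < A ^ p := by positivity
    calc A ^ p * (1 + ‖y‖ ^ 2 / A) ^ p ≤ A ^ p * (1 + p * (‖y‖ ^ 2 / A)) := by gcongr
      _ = A ^ p + p * (A ^ p / A) * ‖y‖ ^ 2 := by field_simp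
      _ ≤ A ^ p + 1 * ‖y‖ ^ 2 := by
          have : A ^ p / A ≤ 1 := by rw [div_le_one hA0]; exact hAp
          have h0 : 0 ≤ A ^ p / A := by positivity
          have : p * (A ^ p / A) ≤ 1 := by nlinarith
          gcongr
      _ = _ := by ring
  rcases min_choice (‖y‖ ^ 2) (‖y‖ ^ (2 * p)) with h | h <;> rw [h] <;> linarith

lemma mk_integrable {n : ℕ} (hn : 0 < n) {p s : ℝ} (hp : 0 < p) (hps : p < s) (hs1 : s < 1) :
    Integrable (fun y : En n => mfun p y * (‖y‖ ^ ((n : ℝ) + 2 * s))⁻¹) := by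
  have : Nontrivial (En n) := by
    have : Nonempty (Fin n) := ⟨⟨0, hn⟩⟩
    infer_instance
  have key := integrable_fun_norm_addHaar (μ := (volume : Measure (En n)))
    (f := fun r : ℝ => min (r ^ 2) (r ^ (2 * p)) * (r ^ ((n : ℝ) + 2 * s))⁻¹)
  refine key.2 ?_
  have hdim : Module.finrank ℝ (En n) = n := by simp
  rw [hdim]
  have hmeas : Measurable (fun y : ℝ => y ^ (n - 1) •
      (min (y ^ 2) (y ^ (2 * p)) * (y ^ ((n : ℝ) + 2 * s))⁻¹)) := by
    fun_prop
  rw [← Ioc_union_Ioi_eq_Ioi (zero_le_one (α := ℝ))]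
  have hpow : ∀ y : ℝ, 0 < y → (y ^ (n - 1) : ℝ) = y ^ ((n : ℝ) - 1) := by
    intro y hy
    rw [← Real.rpow_natCast, Nat.cast_sub hn, Nat.cast_one]
  refine IntegrableOn.union ?_ ?_
  · have h1 : IntegrableOn (fun y : ℝ => y ^ (1 - 2 * s)) (Ioc 0 1) := by
      have := intervalIntegral.intervalIntegrable_rpow' (a := 0) (b := 1) (r := 1 - 2 * s)
        (by linarith)
      rwa [intervalIntegrable_iff_integrableOn_Ioc_of_le zero_le_one] at this
    refine Integrable.mono' h1 hmeas.aestronglyMeasurable ?_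
    refine (ae_restrict_iff' measurableSet_Ioc).2 (Eventually.of_forall fun y hy => ?_)
    have hy0 : 0 < y := hy.1
    rw [Real.norm_of_nonneg (by positivity), smul_eq_mul, hpow y hy0]
    calc y ^ ((n : ℝ) - 1) * (min (y ^ 2) (y ^ (2 * p)) * (y ^ ((n : ℝ) + 2 * s))⁻¹)
        ≤ y ^ ((n : ℝ) - 1) * (y ^ (2 : ℝ) * (y ^ ((n : ℝ) + 2 * s))⁻¹) := by
          gcongr
          have : y ^ (2 : ℝ) = y ^ 2 := by norm_cast
          rw [this]; exact min_le_left _ _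
      _ = y ^ (1 - 2 * s) := by
          rw [← Real.rpow_neg hy0.le, ← Real.rpow_add hy0, ← Real.rpow_add hy0]
          congr 1; ring
  · have h1 : IntegrableOn (fun y : ℝ => y ^ (2 * p - 1 - 2 * s)) (Ioi 1) :=
      integrableOn_Ioi_rpow_of_lt (by linarith) one_pos
    refine Integrable.mono' h1 hmeas.aestronglyMeasurable ?_
    refine (ae_restrict_iff' measurableSet_Ioi).2 (Eventually.of_forall fun y hy => ?_)
    have hy0 : 0 < y := lt_trans one_pos hy
    rw [Real.norm_of_nonneg (by positivity), smul_eq_mul, hpow y hy0]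
    calc y ^ ((n : ℝ) - 1) * (min (y ^ 2) (y ^ (2 * p)) * (y ^ ((n : ℝ) + 2 * s))⁻¹)
        ≤ y ^ ((n : ℝ) - 1) * (y ^ (2 * p) * (y ^ ((n : ℝ) + 2 * s))⁻¹) := by
          gcongr
          exact min_le_right _ _
      _ = y ^ (2 * p - 1 - 2 * s) := by
          rw [← Real.rpow_neg hy0.le, ← Real.rpow_add hy0, ← Real.rpow_add hy0]
          congr 1; ring

lemma growth_consts {c γ p : ℝ} (hc : 0 < c) (hγ : 0 < γ) (hγp : γ < 2 * p) :
    ∃ b > (0 : ℝ), ∃ R0 > (0 : ℝ), (∀ r : ℝ, 0 ≤ r → (c + r) ^ γ ≤ b + 1 / 2 * ((1 + r ^ 2) ^ p - 1)) ∧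
      ∀ r ≥ R0, 4 * b ≤ (1 + r ^ 2) ^ p - 1 := by
  have hp : 0 < p := by linarith
  set D : ℝ := ((2 : ℝ) ^ (γ + 1)) ^ (1 / (2 * p - γ)) with hD
  have hD0 : 0 < D := by positivity
  have hlow : ∀ r : ℝ, 0 ≤ r → r ^ (2 * p) ≤ (1 + r ^ 2) ^ p := by
    intro r hr
    rw [Real.rpow_mul hr]
    apply Real.rpow_le_rpow (by positivity) _ hp.le
    norm_num
  set b : ℝ := 1 / 2 + (2 * c) ^ γ + (2 * D) ^ γ with hb
  have hb0 : 0 < b := by positivity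
  refine ⟨b, hb0, (4 * b + 1) ^ (1 / (2 * p)), by positivity, ?_, ?_⟩
  · intro r hr
    have h1 := hlow r hr
    suffices (c + r) ^ γ ≤ (2 * c) ^ γ + (2 * D) ^ γ + 1 / 2 * r ^ (2 * p) by linarith
    have pc : 0 < (2 * c) ^ γ := by positivity
    have pD : 0 < (2 * D) ^ γ := by positivity
    have pr : 0 ≤ r ^ (2 * p) := by positivity
    rcases le_total r c with h | h
    · have : (c + r) ^ γ ≤ (2 * c) ^ γ := Real.rpow_le_rpow (by linarith) (by linarith) hγ.le
      linarith
    rcases le_total r D with h' | h'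
    · have : (c + r) ^ γ ≤ (2 * D) ^ γ := Real.rpow_le_rpow (by linarith) (by linarith) hγ.le
      linarith
    have hr0 : 0 < r := by linarith
    have h3 : (c + r) ^ γ ≤ (2 * r) ^ γ := Real.rpow_le_rpow (by linarith) (by linarith) hγ.le
    have h4 : (2 : ℝ) ^ (γ + 1) ≤ r ^ (2 * p - γ) := by
      have := Real.rpow_le_rpow hD0.le h' (z := 2 * p - γ) (by linarith)
      rwa [hD, ← Real.rpow_mul (by positivity), one_div, inv_mul_cancel₀ (by linarith),
        Real.rpow_one] at this
    have h5 : (2 * r) ^ γ ≤ 1 / 2 * r ^ (2 * p) := by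
      rw [Real.mul_rpow (by norm_num) hr0.le]
      have e : r ^ (2 * p) = r ^ (2 * p - γ) * r ^ γ := by
        rw [← Real.rpow_add hr0]; congr 1; ring
      rw [e]
      rw [Real.rpow_add (by norm_num), Real.rpow_one] at h4
      have : 0 < r ^ γ := by positivity
      nlinarith
    linarith
  · intro r hr
    have hr0 : 0 ≤ r := le_trans (by positivity) hr
    have h1 := hlow r hr0
    have := Real.rpow_le_rpow (by positivity) hr (z := 2 * p) (by linarith)
    rw [← Real.rpow_mul (by positivity), one_div, inv_mul_cancel₀ (by linarith),
        Real.rpow_one] at this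
    linarith

/-- The key operator inequality at a touching point (synchronous + mirror coupling). -/
lemma touch {n : ℕ} (hn : 0 < n) {s p ε lam Lam cε : ℝ} (hs : 0 < s) (hs1 : s < 1)
    (hp : 0 < p) (hps : p < s)
    (hε : 0 < ε) (hcε : 0 < cε)
    (hcε2 : ∀ q : ℝ, |q| ≤ 1 / 2 → (1 + q) ^ ε + (1 - q) ^ ε ≤ 2 - cε * q ^ 2)
    (hlam : 0 < lam) (hlL : lam ≤ Lam) {a : En n → ℝ} (ha : KernelBounds lam Lam a)
    {φ : En n → ℝ} (hφ : Continuous φ) {x0 z0 : En n} (hne : x0 ≠ z0)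
    (hix : Integrable (Lintegrand n s a φ x0)) (hiz : Integrable (Lintegrand n s a φ z0))
    {M N : ℝ} (hM : 0 ≤ M) (hN : 0 ≤ N)
    (hmax : ∀ x z : En n, φ x - φ z - M * ‖x - z‖ ^ ε - N * (gfun p x + gfun p z) ≤
      φ x0 - φ z0 - M * ‖x0 - z0‖ ^ ε - N * (gfun p x0 + gfun p z0)) :
    Lop n s a φ x0 - Lop n s a φ z0 ≤
      8 * N * Lam * (∫ y : En n, mfun p y * (‖y‖ ^ ((n : ℝ) + 2 * s))⁻¹)
      - (lam * cε / 64 * ((1 / 4 : ℝ) ^ ((n : ℝ) + 2 * s))⁻¹ * (1 / 16) ^ n *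
          (volume.real (ball (0 : En n) 1))) * M * ‖x0 - z0‖ ^ (ε - 2 * s) := by
  have : Nontrivial (En n) := by
    have : Nonempty (Fin n) := ⟨⟨0, hn⟩⟩
    infer_instance
  set u := x0 - z0 with hu
  set ρ := ‖u‖ with hρ
  have hu0 : u ≠ 0 := sub_ne_zero.2 hne
  have hρ0 : 0 < ρ := norm_pos_iff.2 hu0
  have hp1 : p < 1 := by linarith
  set I0 := ∫ y : En n, mfun p y * (‖y‖ ^ ((n : ℝ) + 2 * s))⁻¹ with hI0
  have hmk := mk_integrable hn hp hps hs1
  set D : En n → En n → ℝ := fun x y => φ (x + y) + φ (x - y) - 2 * φ x with hD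
  have hDc : ∀ x, Continuous (D x) := by intro x; simp only [hD]; fun_prop
  -- pointwise inequality
  have hP : ∀ y y' : En n, D x0 y - D z0 y' ≤
      M * (‖u + (y - y')‖ ^ ε + ‖u - (y - y')‖ ^ ε - 2 * ρ ^ ε) +
        N * (2 * mfun p y + 2 * mfun p y') := by
    intro y y'
    have h1 := hmax (x0 + y) (z0 + y')
    have h2 := hmax (x0 - y) (z0 - y')
    have e1 : x0 + y - (z0 + y') = u + (y - y') := by rw [hu]; abel
    have e2 : x0 - y - (z0 - y') = u - (y - y') := by rw [hu]; abel
    rw [e1] at h1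
    rw [e2] at h2
    have g1 := gfun_second_diff hp hp1 x0 y
    have g2 := gfun_second_diff hp hp1 z0 y'
    have := mul_le_mul_of_nonneg_left (add_le_add g1 g2) hN
    simp only [hD]
    linarith
  have hsync : ∀ y : En n, D x0 y - D z0 y ≤ 4 * N * mfun p y := by
    intro y
    have := hP y y
    simp only [sub_self, add_zero, sub_zero] at this
    rw [← hρ] at this
    linarith
  -- reflection
  set S : En n ≃ₗᵢ[ℝ] En n := (ℝ ∙ u)ᗮ.reflection with hS
  have hSy : ∀ y, y - S y = (2 * (inner ℝ u y / ρ ^ 2)) • u := by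
    intro y
    rw [hS, Submodule.reflection_orthogonal_apply, Submodule.reflection_singleton_apply]
    simp only [RCLike.ofReal_real_eq_id, id]
    rw [two_mul, add_smul, two_smul]
    abel
  have hmir : ∀ y ∈ ball (0 : En n) (ρ / 4), D x0 y - D z0 (S y) ≤
      4 * N * mfun p y - M * cε * ρ ^ ε * (2 * (inner ℝ u y / ρ ^ 2)) ^ 2 := by
    intro y hy
    have hyn : ‖y‖ < ρ / 4 := by simpa using hy
    have h := hP y (S y)
    have hmS : mfun p (S y) = mfun p y := by simp [mfun]
    rw [hmS, hSy] at h
    set q := 2 * (inner ℝ u y / ρ ^ 2) with hq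
    have hqa : |q| ≤ 1 / 2 := by
      have h1 : |inner ℝ u y| ≤ ρ * ‖y‖ := abs_real_inner_le_norm u y
      rw [hq, abs_mul, abs_div, abs_of_pos (by positivity : (0 : ℝ) < 2),
        abs_of_pos (by positivity : 0 < ρ ^ 2)]
      have : |inner ℝ u y| / ρ ^ 2 ≤ 1 / 4 := by
        rw [div_le_iff₀ (by positivity)]
        nlinarith
      linarith
    have hqb := abs_le.1 hqa
    have e1 : ‖u + q • u‖ = (1 + q) * ρ := by
      have : u + q • u = (1 + q) • u := by rw [add_smul, one_smul]
      rw [this, norm_smul, Real.norm_of_nonneg (by linarith)]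
    have e2 : ‖u - q • u‖ = (1 - q) * ρ := by
      have : u - q • u = (1 - q) • u := by rw [sub_smul, one_smul]
      rw [this, norm_smul, Real.norm_of_nonneg (by linarith)]
    rw [e1, e2, Real.mul_rpow (by linarith) hρ0.le, Real.mul_rpow (by linarith) hρ0.le] at h
    have h3 := hcε2 q hqa
    have hρε : 0 < ρ ^ ε := by positivity
    have h4 := mul_le_mul_of_nonneg_left h3 (mul_nonneg hM hρε.le)
    nlinarith
  -- kernel pieces
  set kk : En n → ℝ := fun y => (‖y‖ ^ ((n : ℝ) + 2 * s))⁻¹ with hkk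
  set κ : ℝ := lam * ((ρ / 4) ^ ((n : ℝ) + 2 * s))⁻¹ with hκ
  have hκ0 : 0 < κ := by positivity
  set B := ball (0 : En n) (ρ / 4) with hB
  have hBm : MeasurableSet B := measurableSet_ball
  have hns : 0 < (n : ℝ) + 2 * s := by positivity
  have hkB : ∀ y ∈ B, y ≠ 0 → κ ≤ lam * kk y := by
    intro y hy hy0
    have hyn : ‖y‖ < ρ / 4 := by simpa [hB] using hy
    have hy1 : 0 < ‖y‖ := norm_pos_iff.2 hy0
    simp only [hκ, hkk]
    gcongr
  have hab : ∀ y : En n, y ≠ 0 → lam ≤ a (‖y‖⁻¹ • y) ∧ a (‖y‖⁻¹ • y) ≤ Lam := by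
    intro y hy
    apply ha
    rw [norm_smul, norm_inv, norm_norm, inv_mul_cancel₀ (norm_ne_zero_iff.2 hy)]
  have hae0 : ∀ᵐ y : En n, y ≠ 0 := by
    simp [ae_iff]
  have hkk0 : ∀ y, 0 ≤ kk y := fun y => by simp only [hkk]; positivity
  have hIon : ∀ x, IntegrableOn (D x) B := fun x =>
    ((hDc x).continuousOn.integrableOn_compact (isCompact_closedBall (0 : En n) (ρ / 4))).mono_set
      ball_subset_closedBall
  have hIonS : IntegrableOn (fun y => D z0 (S y)) B :=
    (((hDc z0).comp S.continuous).continuousOn.integrableOn_compact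
      (isCompact_closedBall (0 : En n) (ρ / 4))).mono_set ball_subset_closedBall
  set E : En n → ℝ := fun y => D x0 y - D z0 y with hE
  have hEB : IntegrableOn E B := (hIon x0).sub (hIon z0)
  have hEind : Integrable (B.indicator (fun y => κ * E y)) :=
    (integrable_indicator_iff hBm).2 (hEB.const_mul κ)
  have hdiff : Integrable (fun y => Lintegrand n s a φ x0 y - Lintegrand n s a φ z0 y) :=
    hix.sub hiz
  have hsplit : Lop n s a φ x0 - Lop n s a φ z0 =
      (∫ y, ((Lintegrand n s a φ x0 y - Lintegrand n s a φ z0 y) - B.indicator (fun y => κ * E y) y))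
        + ∫ y, B.indicator (fun y => κ * E y) y := by
    rw [integral_sub hdiff hEind, sub_add_cancel, integral_sub hix hiz]
    rfl
  have hfirst : (∫ y, ((Lintegrand n s a φ x0 y - Lintegrand n s a φ z0 y)
      - B.indicator (fun y => κ * E y) y)) ≤ 4 * N * Lam * I0 := by
    rw [hI0, ← integral_const_mul]
    refine integral_mono_ae (hdiff.sub hEind) (hmk.const_mul _) ?_
    filter_upwards [hae0] with y hy
    obtain ⟨ha1, ha2⟩ := hab y hy
    have hL : Lintegrand n s a φ x0 y - Lintegrand n s a φ z0 y = E y * (a (‖y‖⁻¹ • y) * kk y) := by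
      simp only [Lintegrand, hE, hD, hkk]
      ring
    have hk := hkk0 y
    have hsy : E y ≤ 4 * N * mfun p y := hsync y
    have hm := mfun_nonneg (p := p) y
    have key : ∀ w : ℝ, 0 ≤ w → w ≤ Lam * kk y → E y * w ≤ 4 * N * Lam * (mfun p y * kk y) := by
      intro w hw hw2
      calc E y * w ≤ (4 * N * mfun p y) * w := by gcongr
        _ ≤ (4 * N * mfun p y) * (Lam * kk y) := by gcongr
        _ = _ := by ring
    rw [hL]
    by_cases hyB : y ∈ B
    · rw [indicator_of_mem hyB]
      have h1 := hkB y hyB hy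
      have h2 : lam * kk y ≤ a (‖y‖⁻¹ • y) * kk y := by gcongr
      have h3 : a (‖y‖⁻¹ • y) * kk y ≤ Lam * kk y := by gcongr
      have := key (a (‖y‖⁻¹ • y) * kk y - κ) (by linarith) (by linarith)
      linarith
    · rw [indicator_of_notMem hyB, sub_zero]
      exact key _ (mul_nonneg (by linarith) hk) (by gcongr)
  -- second part
  set B' := ball ((1 / 8 : ℝ) • u) (ρ / 16) with hB'
  have hB'm : MeasurableSet B' := measurableSet_ball
  have hB'B : B' ⊆ B := by
    intro y hy
    have hy1 : ‖y - (1 / 8 : ℝ) • u‖ < ρ / 16 := by simpa [hB', dist_eq_norm] using hy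
    have : ‖y‖ ≤ ‖y - (1 / 8 : ℝ) • u‖ + ‖(1 / 8 : ℝ) • u‖ := by
      simpa using norm_add_le (y - (1 / 8 : ℝ) • u) ((1 / 8 : ℝ) • u)
    rw [norm_smul, Real.norm_of_nonneg (by norm_num)] at this
    simp only [hB, mem_ball, dist_zero_right]
    linarith
  have hinner : ∀ y ∈ B', 1 / 64 ≤ (2 * (inner ℝ u y / ρ ^ 2)) ^ 2 := by
    intro y hy
    have hy1 : ‖y - (1 / 8 : ℝ) • u‖ < ρ / 16 := by simpa [hB', dist_eq_norm] using hy
    have h1 : |inner ℝ u (y - (1 / 8 : ℝ) • u)| ≤ ρ * ‖y - (1 / 8 : ℝ) • u‖ :=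
      abs_real_inner_le_norm _ _
    rw [inner_sub_right, inner_smul_right, real_inner_self_eq_norm_sq, ← hρ] at h1
    have h2 := (abs_le.1 h1).1
    have h3 : ρ ^ 2 / 16 ≤ inner ℝ u y := by nlinarith
    have h4 : 1 / 16 ≤ inner ℝ u y / ρ ^ 2 := by
      rw [le_div_iff₀ (by positivity)]; linarith
    nlinarith
  have hSint : ∫ y in B, D z0 y = ∫ y in B, D z0 (S y) := by
    have hpre : S ⁻¹' B = B := by
      ext y; simp [hB]
    have := S.measurePreserving.setIntegral_preimage_emb
      S.toHomeomorph.measurableEmbedding (D z0) B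
    rw [hpre] at this
    exact this.symm
  set T : ℝ := M * cε * ρ ^ ε / 64 with hT
  have hT0 : 0 ≤ T := by positivity
  have hmB : IntegrableOn (fun y : En n => κ * mfun p y) B := by
    refine Integrable.mono' ((hmk.const_mul lam).integrableOn (s := B)) ?_ ?_
    · have : Measurable (fun y : En n => κ * mfun p y) := by unfold mfun; fun_prop
      exact this.aestronglyMeasurable
    · filter_upwards [ae_restrict_mem hBm, ae_restrict_of_ae hae0] with y hy hy0
      rw [Real.norm_of_nonneg (mul_nonneg hκ0.le (mfun_nonneg y))]
      have := hkB y hy hy0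
      have hm := mfun_nonneg (p := p) y
      calc κ * mfun p y ≤ (lam * kk y) * mfun p y := by gcongr
        _ = _ := by simp only [hkk]; ring
  have hmBle : ∫ y in B, κ * mfun p y ≤ Lam * I0 := by
    have h1 : ∫ y in B, κ * mfun p y ≤ ∫ y in B, Lam * (mfun p y * kk y) := by
      refine integral_mono_ae hmB ((hmk.const_mul Lam).integrableOn) ?_
      filter_upwards [ae_restrict_mem hBm, ae_restrict_of_ae hae0] with y hy hy0
      have := hkB y hy hy0
      have hm := mfun_nonneg (p := p) y
      have hk := hkk0 y
      calc κ * mfun p y ≤ (lam * kk y) * mfun p y := by gcongr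
        _ ≤ (Lam * kk y) * mfun p y := by gcongr
        _ = _ := by ring
    have h2 : ∫ y in B, Lam * (mfun p y * kk y) ≤ ∫ y, Lam * (mfun p y * kk y) := by
      refine setIntegral_le_integral (hmk.const_mul Lam) (Eventually.of_forall fun y => ?_)
      exact mul_nonneg (by linarith) (mul_nonneg (mfun_nonneg y) (hkk0 y))
    have h3 : ∫ y, Lam * (mfun p y * kk y) = Lam * I0 := integral_const_mul _ _
    rw [h3] at h2
    exact h1.trans h2
  have hB'int : IntegrableOn (B'.indicator (fun _ : En n => κ * T)) B := by
    refine Integrable.integrableOn ((integrable_indicator_iff hB'm).2 ?_)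
    exact integrableOn_const measure_ball_lt_top.ne
  have hsecond : ∫ y, B.indicator (fun y => κ * E y) y ≤
      4 * N * (Lam * I0) - κ * T * volume.real B' := by
    rw [integral_indicator hBm, integral_const_mul]
    have e1 : ∫ y in B, E y = ∫ y in B, (D x0 y - D z0 (S y)) := by
      rw [integral_sub (hIon x0) hIonS, ← hSint, ← integral_sub (hIon x0) (hIon z0)]
    rw [e1, ← integral_const_mul]
    have h1 : ∫ y in B, κ * (D x0 y - D z0 (S y)) ≤
        ∫ y in B, (4 * N * (κ * mfun p y) - B'.indicator (fun _ : En n => κ * T) y) := by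
      refine integral_mono_ae (((hIon x0).sub hIonS).const_mul κ)
        ((hmB.const_mul _).sub hB'int) ?_
      filter_upwards [ae_restrict_mem hBm] with y hy
      have h2 := hmir y hy
      by_cases hy' : y ∈ B'
      · rw [indicator_of_mem hy']
        have h3 := mul_le_mul_of_nonneg_left (hinner y hy')
          (show 0 ≤ M * cε * ρ ^ ε by positivity)
        have : D x0 y - D z0 (S y) ≤ 4 * N * mfun p y - T := by rw [hT]; linarith
        have := mul_le_mul_of_nonneg_left this hκ0.le
        linarith
      · rw [indicator_of_notMem hy']
        have h3 : 0 ≤ M * cε * ρ ^ ε * (2 * (inner ℝ u y / ρ ^ 2)) ^ 2 := by positivity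
        have : D x0 y - D z0 (S y) ≤ 4 * N * mfun p y := by linarith
        have := mul_le_mul_of_nonneg_left this hκ0.le
        linarith
    rw [integral_sub (hmB.const_mul _) hB'int, integral_const_mul (4 * N),
      setIntegral_indicator hB'm, inter_eq_self_of_subset_right hB'B, setIntegral_const,
      smul_eq_mul] at h1
    have h4 := mul_le_mul_of_nonneg_left hmBle (show 0 ≤ 4 * N by positivity)
    linarith
  have hvol : volume.real B' = (ρ / 16) ^ n * volume.real (ball (0 : En n) 1) := by
    rw [hB', Measure.real, Measure.addHaar_ball _ _ (by positivity), ENNReal.toReal_mul,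
      ENNReal.toReal_ofReal (by positivity)]
    simp [Measure.real]
  have hfin : κ * T * volume.real B' = (lam * cε / 64 * ((1 / 4 : ℝ) ^ ((n : ℝ) + 2 * s))⁻¹ *
      (1 / 16) ^ n * (volume.real (ball (0 : En n) 1))) * M * ρ ^ (ε - 2 * s) := by
    have e : ρ ^ (ε - 2 * s) = ρ ^ ε * (ρ ^ ((n : ℝ) + 2 * s))⁻¹ * ρ ^ n := by
      rw [← Real.rpow_neg hρ0.le, ← Real.rpow_natCast, ← Real.rpow_add hρ0, ← Real.rpow_add hρ0]
      congr 1; ring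
    rw [hvol, hT, hκ, e, div_eq_mul_one_div ρ 4, Real.mul_rpow hρ0.le (by norm_num), mul_inv,
      div_eq_mul_one_div ρ 16, mul_pow]
    ring
  rw [hsplit, ← hfin]
  linarith

set_option maxHeartbeats 1000000 in
lemma unit_holder {n : ℕ} (hn : 0 < n) {s γ ε lam Lam c : ℝ} (hs : 0 < s) (hs1 : s < 1)
    (hγ : 0 < γ) (hγs : γ < 2 * s) (hε : 0 < ε) (hε1 : ε < 1) (hεs : ε ≤ 2 * s)
    (hlam : 0 < lam) (hlL : lam ≤ Lam) (hc : 0 < c) {a : En n → ℝ} (ha : KernelBounds lam Lam a) :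
    ∃ M > (0 : ℝ), ∀ (U : ℝ → En n → ℝ) (A : ℝ), 0 < A →
      ContinuousOn (fun z : ℝ × En n => U z.1 z.2) (Icc (-1) 0 ×ˢ univ) →
      (∀ t ∈ Icc (-1 : ℝ) 0, ∀ x, |U t x| ≤ A * (c + ‖x‖) ^ γ) →
      (∀ t ∈ Icc (-1 : ℝ) 0, ∀ x, SolvesAt n s a U (fun _ _ => 0) t x) →
      ∀ x, ‖x‖ ≤ 1 → U 0 x - U 0 0 ≤ M * A * ‖x‖ ^ ε := by
  obtain ⟨cε, hcε, hcε2⟩ := aux_pow_second_diff ε hε hε1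
  obtain ⟨p, hp1', hp2'⟩ := exists_between (show γ / 2 < s by linarith)
  have hp : 0 < p := by linarith
  have hp1 : p < 1 := by linarith
  obtain ⟨b, hb, R0, hR0, hg1, hg2⟩ := growth_consts (p := p) hc hγ (by linarith)
  set I0 := ∫ y : En n, mfun p y * (‖y‖ ^ ((n : ℝ) + 2 * s))⁻¹ with hI0
  have hI0n : 0 ≤ I0 := integral_nonneg fun y => mul_nonneg (mfun_nonneg y) (by positivity)
  have hω : 0 < volume.real (ball (0 : En n) 1) :=
    ENNReal.toReal_pos (measure_ball_pos _ _ one_pos).ne' measure_ball_lt_top.ne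
  set c3 := lam * cε / 64 * ((1 / 4 : ℝ) ^ ((n : ℝ) + 2 * s))⁻¹ * (1 / 16) ^ n *
          (volume.real (ball (0 : En n) 1)) with hc3
  have hc30 : 0 < c3 := by positivity
  have hLam : 0 < Lam := by linarith
  set M := 2 * b + (8 * Lam * I0 + 2 * b + 1) / c3 with hM
  have hM0 : 0 < M := by positivity
  refine ⟨M + 1, by positivity, fun U A hA hcont hgr hsol => ?_⟩
  -- the doubled function
  set Φ : ℝ × En n × En n → ℝ := fun P => U P.1 P.2.1 - U P.1 P.2.2
    - (M * A) * ‖P.2.1 - P.2.2‖ ^ ε - A * (gfun p P.2.1 + gfun p P.2.2) + 2 * b * A * P.1 with hΦ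
  have hdiff : ∀ t ∈ Icc (-1 : ℝ) 0, ∀ x z, U t x - U t z ≤
      A * (2 * b + 1 / 2 * (gfun p x + gfun p z)) := by
    intro t ht x z
    have h1 := (abs_le.1 (hgr t ht x)).2
    have h2 := (abs_le.1 (hgr t ht z)).1
    have h3 := mul_le_mul_of_nonneg_left (hg1 ‖x‖ (norm_nonneg _)) hA.le
    have h4 := mul_le_mul_of_nonneg_left (hg1 ‖z‖ (norm_nonneg _)) hA.le
    unfold gfun
    linarith
  suffices hmain : ∀ t ∈ Icc (-1 : ℝ) 0, ∀ x z, Φ (t, x, z) ≤ 0 by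
    intro x hx
    have h := hmain 0 (by simp) x 0
    simp only [hΦ, sub_zero, mul_zero, add_zero] at h
    have g0 : gfun p (0 : En n) = 0 := by simp [gfun]
    have gx := gfun_le_sq hp hp1 x
    have hx2 : ‖x‖ ^ 2 ≤ ‖x‖ ^ ε := by
      rcases eq_or_lt_of_le (norm_nonneg x) with h0 | h0
      · rw [← h0]; simp [Real.zero_rpow hε.ne']
      · have := Real.rpow_le_rpow_of_exponent_ge h0 hx (show ε ≤ 2 by linarith)
        simpa using this
    rw [g0] at h
    have := mul_le_mul_of_nonneg_left (gx.trans hx2) hA.le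
    linarith
  have hout : ∀ t ∈ Icc (-1 : ℝ) 0, ∀ x z, (R0 ≤ ‖x‖ ∨ R0 ≤ ‖z‖) → Φ (t, x, z) ≤ 0 := by
    intro t ht x z hxz
    have h1 := hdiff t ht x z
    have gx := gfun_nonneg hp x
    have gz := gfun_nonneg hp z
    have h2 : 4 * b ≤ gfun p x + gfun p z := by
      rcases hxz with h | h
      · have := hg2 _ h
        change 4 * b ≤ gfun p x at this
        linarith
      · have := hg2 _ h
        change 4 * b ≤ gfun p z at this
        linarith
    have h3 : 0 ≤ (M * A) * ‖x - z‖ ^ ε := by positivity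
    have h4 : 2 * b * A * t ≤ 0 := mul_nonpos_of_nonneg_of_nonpos (by positivity) ht.2
    have h5 := mul_le_mul_of_nonneg_left h2 hA.le
    simp only [hΦ]
    linarith
  by_contra hcon
  push Not at hcon
  obtain ⟨t1, ht1, x1, z1, hpos⟩ := hcon
  set Kc : Set (ℝ × En n × En n) :=
    Icc (-1) 0 ×ˢ (closedBall (0 : En n) R0 ×ˢ closedBall (0 : En n) R0) with hKc
  have hKcc : IsCompact Kc :=
    isCompact_Icc.prod ((isCompact_closedBall _ _).prod (isCompact_closedBall _ _))
  have hΦc : ContinuousOn Φ Kc := by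
    have c1 : ContinuousOn (fun P : ℝ × En n × En n => U P.1 P.2.1) Kc :=
      hcont.comp (f := fun P : ℝ × En n × En n => (P.1, P.2.1)) (by fun_prop)
        (fun P hP => ⟨hP.1, mem_univ _⟩)
    have c2 : ContinuousOn (fun P : ℝ × En n × En n => U P.1 P.2.2) Kc :=
      hcont.comp (f := fun P : ℝ × En n × En n => (P.1, P.2.2)) (by fun_prop)
        (fun P hP => ⟨hP.1, mem_univ _⟩)
    have c3 : Continuous (fun P : ℝ × En n × En n => ‖P.2.1 - P.2.2‖ ^ ε) :=
      Continuous.rpow_const (by fun_prop) (fun _ => Or.inr hε.le)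
    have c4 : Continuous (fun P : ℝ × En n × En n => gfun p P.2.1) :=
      (gfun_continuous hp).comp (by fun_prop)
    have c5 : Continuous (fun P : ℝ × En n × En n => gfun p P.2.2) :=
      (gfun_continuous hp).comp (by fun_prop)
    simp only [hΦ]
    exact (((c1.sub c2).sub (continuousOn_const.mul c3.continuousOn)).sub
      (continuousOn_const.mul (c4.add c5).continuousOn)).add
      (Continuous.continuousOn (by fun_prop))
  have hinK : ∀ t ∈ Icc (-1 : ℝ) 0, ∀ x z, 0 < Φ (t, x, z) → (t, x, z) ∈ Kc := by
    intro t ht x z h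
    refine ⟨ht, ?_, ?_⟩
    · by_contra hx
      simp only [mem_closedBall, dist_zero_right, not_le] at hx
      linarith [hout t ht x z (Or.inl hx.le)]
    · by_contra hx
      simp only [mem_closedBall, dist_zero_right, not_le] at hx
      linarith [hout t ht x z (Or.inr hx.le)]
  obtain ⟨⟨t0, x0, z0⟩, hPK, hPmax⟩ := hKcc.exists_isMaxOn ⟨_, hinK t1 ht1 x1 z1 hpos⟩ hΦc
  have ht0 : t0 ∈ Icc (-1 : ℝ) 0 := hPK.1
  have hpos0 : 0 < Φ (t0, x0, z0) := lt_of_lt_of_le hpos (hPmax (hinK t1 ht1 x1 z1 hpos))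
  have hglob : ∀ t ∈ Icc (-1 : ℝ) 0, ∀ x z, Φ (t, x, z) ≤ Φ (t0, x0, z0) := by
    intro t ht x z
    by_cases h : 0 < Φ (t, x, z)
    · exact hPmax (hinK t ht x z h)
    · linarith
  have gx := gfun_nonneg hp x0
  have gz := gfun_nonneg hp z0
  have hAg : 0 ≤ A * (gfun p x0 + gfun p z0) := mul_nonneg hA.le (by linarith)
  have hd0 := hdiff t0 ht0 x0 z0
  have htn : 2 * b * A * t0 ≤ 0 := mul_nonpos_of_nonneg_of_nonpos (by positivity) ht0.2
  have hne : x0 ≠ z0 := by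
    rintro rfl
    simp only [hΦ, sub_self, norm_zero, Real.zero_rpow hε.ne'] at hpos0
    linarith
  have hρ0 : 0 < ‖x0 - z0‖ := norm_pos_iff.2 (sub_ne_zero.2 hne)
  have hMb : 2 * b ≤ M := by
    have : 0 ≤ (8 * Lam * I0 + 2 * b + 1) / c3 := by positivity
    linarith
  have hρ1 : ‖x0 - z0‖ < 1 := by
    by_contra h
    push Not at h
    have h1 : 1 ≤ ‖x0 - z0‖ ^ ε := Real.one_le_rpow h hε.le
    have h2 : 2 * b * A ≤ M * A * ‖x0 - z0‖ ^ ε := by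
      calc 2 * b * A ≤ M * A := by gcongr
        _ = M * A * 1 := by ring
        _ ≤ _ := by gcongr
    simp only [hΦ] at hpos0
    linarith
  have ht0' : -1 < t0 := by
    rcases eq_or_lt_of_le ht0.1 with h | h
    · exfalso
      have h2 : 0 ≤ M * A * ‖x0 - z0‖ ^ ε := by positivity
      simp only [hΦ, ← h] at hpos0
      rw [← h] at hd0
      linarith
    · exact h
  obtain ⟨hix, hdx⟩ := hsol t0 ht0 x0
  obtain ⟨hiz, hdz⟩ := hsol t0 ht0 z0
  have hφc : Continuous (U t0) := by
    have := hcont.comp (f := fun x : En n => (t0, x)) (s := univ) (by fun_prop)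
      (fun x _ => ⟨ht0, mem_univ _⟩)
    exact continuousOn_univ.1 this
  have htouch := touch hn hs hs1 hp hp2' hε hcε hcε2 hlam hlL ha hφc hne hix hiz
    (M := M * A) (N := A) (by positivity) hA.le (by
      intro x z
      have := hglob t0 ht0 x z
      simp only [hΦ] at this
      linarith)
  rw [← hI0, ← hc3] at htouch
  -- time derivative
  have hder : HasDerivAt (fun t => U t x0 - U t z0 + 2 * b * A * t)
      (Lop n s a (U t0) x0 - Lop n s a (U t0) z0 + 2 * b * A) t0 := by
    have := (hdx.sub hdz).add ((hasDerivAt_id t0).const_mul (2 * b * A))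
    refine this.congr_deriv ?_
    simp
  have hder0 : 0 ≤ Lop n s a (U t0) x0 - Lop n s a (U t0) z0 + 2 * b * A := by
    by_contra hneg
    push Not at hneg
    have hlt := (hasDerivAt_iff_tendsto_slope_left_right.1 hder).1
    have hev : ∀ᶠ t in 𝓝[<] t0, slope (fun t => U t x0 - U t z0 + 2 * b * A * t) t0 t < 0 :=
      hlt.eventually (gt_mem_nhds hneg)
    have hev2 : ∀ᶠ t in 𝓝[<] t0, t ∈ Ioo (-1) t0 := Ioo_mem_nhdsLT ht0'
    obtain ⟨t, ht, ht2⟩ := (hev.and hev2).exists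
    have hh := hglob t ⟨ht2.1.le, by linarith [ht2.2, ht0.2]⟩ x0 z0
    simp only [hΦ] at hh
    rw [slope_def_field] at ht
    have : 0 ≤ ((U t x0 - U t z0 + 2 * b * A * t) - (U t0 x0 - U t0 z0 + 2 * b * A * t0)) / (t - t0) :=
      div_nonneg_of_nonpos (by linarith) (by linarith [ht2.2])
    linarith
  have hρpow : 1 ≤ ‖x0 - z0‖ ^ (ε - 2 * s) :=
    Real.one_le_rpow_of_pos_of_le_one_of_nonpos hρ0 hρ1.le (by linarith)
  have h1 : c3 * (M * A) ≤ c3 * (M * A) * ‖x0 - z0‖ ^ (ε - 2 * s) :=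
    le_mul_of_one_le_right (by positivity) hρpow
  have h2 : 8 * Lam * I0 + 2 * b + 1 ≤ c3 * M := by
    have : c3 * ((8 * Lam * I0 + 2 * b + 1) / c3) = 8 * Lam * I0 + 2 * b + 1 := by field_simp
    rw [hM, mul_add, this]
    have : 0 < c3 * (2 * b) := by positivity
    linarith
  have h3 := mul_le_mul_of_nonneg_right h2 hA.le
  linarith

lemma solvesAt_sub {n : ℕ} {s : ℝ} {a : En n → ℝ} {u v : ℝ → En n → ℝ} {t : ℝ} {x : En n}
    (hu : SolvesAt n s a u (fun _ _ => 0) t x) (hv : SolvesAt n s a v (fun _ _ => 0) t x) :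
    SolvesAt n s a (fun t x => u t x - v t x) (fun _ _ => 0) t x := by
  obtain ⟨hu1, hu2⟩ := hu
  obtain ⟨hv1, hv2⟩ := hv
  have e : Lintegrand n s a (fun x => u t x - v t x) x =
      fun y => Lintegrand n s a (u t) x y - Lintegrand n s a (v t) x y := by
    funext y; simp only [Lintegrand]; ring
  refine ⟨?_, ?_⟩
  · show Integrable (Lintegrand n s a (fun x => u t x - v t x) x)
    rw [e]; exact hu1.sub hv1
  · have : Lop n s a (fun x => u t x - v t x) x = Lop n s a (u t) x - Lop n s a (v t) x := by
      unfold Lop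
      rw [e, integral_sub hu1 hv1]
    refine (hu2.sub hv2).congr_deriv ?_
    show _ = Lop n s a (fun x => u t x - v t x) x + 0
    rw [this]; ring

lemma solvesAt_shift {n : ℕ} {s : ℝ} {a : En n → ℝ} {u : ℝ → En n → ℝ} {t : ℝ} {x k : En n}
    (hu : SolvesAt n s a u (fun _ _ => 0) t (x + k)) :
    SolvesAt n s a (fun t x => u t (x + k)) (fun _ _ => 0) t x := by
  obtain ⟨hu1, hu2⟩ := hu
  have e : Lintegrand n s a (fun x => u t (x + k)) x = Lintegrand n s a (u t) (x + k) := by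
    funext y
    simp only [Lintegrand]
    rw [show x + y + k = x + k + y by abel, show x - y + k = x + k - y by abel]
  refine ⟨?_, ?_⟩
  · show Integrable (Lintegrand n s a (fun x => u t (x + k)) x)
    rw [e]; exact hu1
  · have : Lop n s a (fun x => u t (x + k)) x = Lop n s a (u t) (x + k) := by
      unfold Lop
      rw [e]
    refine hu2.congr_deriv ?_
    show _ = Lop n s a (fun x => u t (x + k)) x + 0
    rw [this]

lemma solvesAt_zero {n : ℕ} {s : ℝ} {a : En n → ℝ} {t : ℝ} {x : En n} :
    SolvesAt n s a (fun _ _ => 0) (fun _ _ => 0) t x := by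
  have e : Lintegrand n s a (fun _ => 0) x = fun _ => 0 := by
    funext y; simp [Lintegrand]
  refine ⟨?_, ?_⟩
  · show Integrable (Lintegrand n s a (fun _ => 0) x)
    rw [e]; exact integrable_zero _ _ _
  · have : Lop n s a (fun _ => 0) x = 0 := by
      unfold Lop
      rw [e]; simp
    refine (hasDerivAt_const t (0 : ℝ)).congr_deriv ?_
    show _ = Lop n s a (fun _ => 0) x + 0
    rw [this, add_zero]

lemma solvesAt_rescale {n : ℕ} {s : ℝ} {a : En n → ℝ} {u : ℝ → En n → ℝ} {R tb t : ℝ} {xb x : En n}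
    (hR : 0 < R) (hu : SolvesAt n s a u (fun _ _ => 0) (tb + R ^ (2 * s) * t) (xb + R • x)) :
    SolvesAt n s a (fun t x => u (tb + R ^ (2 * s) * t) (xb + R • x)) (fun _ _ => 0) t x := by
  obtain ⟨hu1, hu2⟩ := hu
  set T := tb + R ^ (2 * s) * t with hT
  set F := Lintegrand n s a (u T) (xb + R • x) with hF
  have e : Lintegrand n s a (fun x => u T (xb + R • x)) x =
      fun y => R ^ ((n : ℝ) + 2 * s) * F (R • y) := by
    funext y
    simp only [Lintegrand, hF]
    rw [show xb + R • (x + y) = xb + R • x + R • y by rw [smul_add]; abel,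
      show xb + R • (x - y) = xb + R • x - R • y by rw [smul_sub]; abel, norm_smul,
      Real.norm_of_nonneg hR.le, Real.mul_rpow hR.le (norm_nonneg y), smul_smul,
      show (R * ‖y‖)⁻¹ * R = ‖y‖⁻¹ by rw [mul_inv]; field_simp]
    have : R ^ ((n : ℝ) + 2 * s) ≠ 0 := by positivity
    field_simp
  have hdim : Module.finrank ℝ (En n) = n := by simp
  refine ⟨?_, ?_⟩
  · show Integrable (Lintegrand n s a (fun x => u T (xb + R • x)) x)
    rw [e]
    exact (hu1.comp_smul hR.ne').const_mul _
  · have : Lop n s a (fun x => u T (xb + R • x)) x = R ^ (2 * s) * Lop n s a (u T) (xb + R • x) := by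
      unfold Lop
      rw [e, integral_const_mul, Measure.integral_comp_smul, hdim, smul_eq_mul,
        abs_of_pos (by positivity), Real.rpow_add hR, Real.rpow_natCast]
      have : R ^ n ≠ 0 := by positivity
      field_simp
      rfl
    have hin : HasDerivAt (fun t : ℝ => tb + R ^ (2 * s) * t) (R ^ (2 * s)) t := by
      simpa using ((hasDerivAt_id t).const_mul (R ^ (2 * s))).const_add tb
    have := HasDerivAt.comp t hu2 hin
    refine this.congr_deriv ?_
    show _ = Lop n s a (fun x => u T (xb + R • x)) x + 0
    rw [‹Lop n s a (fun x => u T (xb + R • x)) x = _›]; ring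

/-- classical ancient solutions -/
structure Sol (n : ℕ) (s : ℝ) (a : En n → ℝ) (u : ℝ → En n → ℝ) : Prop where
  cont : ContinuousOn (fun z : ℝ × En n => u z.1 z.2) (Iio 0 ×ˢ univ)
  solves : ∀ t < (0 : ℝ), ∀ x, SolvesAt n s a u (fun _ _ => 0) t x

def Gr {n : ℕ} (s γ K : ℝ) (u : ℝ → En n → ℝ) : Prop :=
  ∀ R ≥ (1 : ℝ), ∀ t ∈ Ioo (-(R ^ (2 * s))) 0, ∀ x ∈ ball (0 : En n) R, |u t x| ≤ K * R ^ γ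

lemma Sol.sub {n : ℕ} {s : ℝ} {a : En n → ℝ} {u v : ℝ → En n → ℝ} (hu : Sol n s a u)
    (hv : Sol n s a v) : Sol n s a (fun t x => u t x - v t x) :=
  ⟨hu.cont.sub hv.cont, fun t ht x => solvesAt_sub (hu.solves t ht x) (hv.solves t ht x)⟩

lemma Sol.neg {n : ℕ} {s : ℝ} {a : En n → ℝ} {u : ℝ → En n → ℝ} (hu : Sol n s a u) :
    Sol n s a (fun t x => 0 - u t x) :=
  Sol.sub (u := fun _ _ => 0) ⟨continuousOn_const, fun _ _ _ => solvesAt_zero⟩ hu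

lemma Sol.shift {n : ℕ} {s : ℝ} {a : En n → ℝ} {u : ℝ → En n → ℝ} (hu : Sol n s a u) (k : En n) :
    Sol n s a (fun t x => u t (x + k)) :=
  ⟨hu.cont.comp (f := fun z : ℝ × En n => (z.1, z.2 + k)) (by fun_prop)
    (fun z hz => ⟨hz.1, mem_univ _⟩), fun t ht x => solvesAt_shift (hu.solves t ht (x + k))⟩

lemma holder_one_sided {n : ℕ} (hn : 0 < n) {s γ ε lam Lam : ℝ} (hs : 0 < s) (hs1 : s < 1)
    (hγ : 0 < γ) (hγs : γ < 2 * s) (hε : 0 < ε) (hε1 : ε < 1) (hεs : ε ≤ 2 * s)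
    (hlam : 0 < lam) (hlL : lam ≤ Lam) {a : En n → ℝ} (ha : KernelBounds lam Lam a) :
    ∃ M > (0 : ℝ), ∀ (u : ℝ → En n → ℝ) (K : ℝ), 0 < K → Sol n s a u → Gr s γ K u →
      ∀ R ≥ (1 : ℝ), ∀ t ∈ Ioo (-(R ^ (2 * s))) 0, ∀ x ∈ ball (0 : En n) R, ∀ h : En n, ‖h‖ ≤ R →
        u t (x + h) - u t x ≤ M * K * R ^ (γ - ε) * ‖h‖ ^ ε := by
  set c : ℝ := 2 ^ (1 / (2 * s)) with hc
  have hc1 : 1 ≤ c := Real.one_le_rpow (by norm_num) (by positivity)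
  have hc2 : c ^ (2 * s) = 2 := by
    rw [hc, ← Real.rpow_mul (by norm_num), one_div, inv_mul_cancel₀ (by positivity), Real.rpow_one]
  obtain ⟨M, hM, H⟩ := unit_holder hn hs hs1 hγ hγs hε hε1 hεs hlam hlL
    (show 0 < c by linarith) ha
  refine ⟨M, hM, fun u K hK hu hg R hR t ht x hx h hh => ?_⟩
  have hR0 : 0 < R := by linarith
  have hRs : 0 < R ^ (2 * s) := by positivity
  have hneg : ∀ t' ∈ Icc (-1 : ℝ) 0, t + R ^ (2 * s) * t' < 0 := by
    intro t' ht'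
    have := mul_nonpos_of_nonneg_of_nonpos hRs.le ht'.2
    linarith [ht.2]
  have key := H (fun t' x' => u (t + R ^ (2 * s) * t') (x + R • x')) (K * R ^ γ) (by positivity)
    (hu.cont.comp (f := fun z : ℝ × En n => (t + R ^ (2 * s) * z.1, x + R • z.2))
      (by fun_prop) (fun z hz => ⟨hneg z.1 hz.1, mem_univ _⟩))
    (by
      intro t' ht' x'
      have hxn : ‖x‖ < R := by simpa using hx
      have hn' := norm_nonneg x'
      have h1 : (1 : ℝ) ≤ R * (c + ‖x'‖) := by nlinarith
      have h2 : R ^ (2 * s) * 2 ≤ (R * (c + ‖x'‖)) ^ (2 * s) := by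
        rw [Real.mul_rpow hR0.le (by linarith)]
        have : 2 ≤ (c + ‖x'‖) ^ (2 * s) :=
          hc2.symm.le.trans (Real.rpow_le_rpow (by linarith) (by linarith) (by positivity))
        exact mul_le_mul_of_nonneg_left this hRs.le
      have h3 := hg (R * (c + ‖x'‖)) h1 (t + R ^ (2 * s) * t')
        ⟨by
          have := mul_le_mul_of_nonneg_left ht'.1 hRs.le
          linarith [ht.1], hneg t' ht'⟩ (x + R • x') (by
          simp only [mem_ball, dist_zero_right]
          have := norm_add_le x (R • x')
          rw [norm_smul, Real.norm_of_nonneg hR0.le] at this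
          nlinarith)
      rw [Real.mul_rpow hR0.le (by linarith), ← mul_assoc] at h3
      exact h3)
    (fun t' ht' x' => solvesAt_rescale hR0 (hu.solves _ (hneg t' ht') _))
    (R⁻¹ • h) (by
      rw [norm_smul, norm_inv, Real.norm_of_nonneg hR0.le, inv_mul_le_iff₀ hR0]
      linarith)
  simp only [mul_zero, add_zero, smul_zero, smul_smul, mul_inv_cancel₀ hR0.ne', one_smul] at key
  refine key.trans (le_of_eq ?_)
  rw [norm_smul, norm_inv, Real.norm_of_nonneg hR0.le, Real.mul_rpow (by positivity) (norm_nonneg _),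
    Real.inv_rpow hR0.le, Real.rpow_sub hR0]
  field_simp

lemma holder_R {n : ℕ} (hn : 0 < n) {s γ ε lam Lam : ℝ} (hs : 0 < s) (hs1 : s < 1)
    (hγ : 0 < γ) (hγs : γ < 2 * s) (hε : 0 < ε) (hε1 : ε < 1) (hεs : ε ≤ 2 * s)
    (hlam : 0 < lam) (hlL : lam ≤ Lam) {a : En n → ℝ} (ha : KernelBounds lam Lam a) :
    ∃ M > (0 : ℝ), ∀ (u : ℝ → En n → ℝ) (K : ℝ), 0 < K → Sol n s a u → Gr s γ K u →
      ∀ R ≥ (1 : ℝ), ∀ t ∈ Ioo (-(R ^ (2 * s))) 0, ∀ x ∈ ball (0 : En n) R, ∀ h : En n, ‖h‖ ≤ R →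
        |u t (x + h) - u t x| ≤ M * K * R ^ (γ - ε) * ‖h‖ ^ ε := by
  obtain ⟨M, hM, H⟩ := holder_one_sided hn hs hs1 hγ hγs hε hε1 hεs hlam hlL ha
  refine ⟨M, hM, fun u K hK hu hg R hR t ht x hx h hh => abs_le.2 ⟨?_, ?_⟩⟩
  · have := H (fun t x => 0 - u t x) K hK hu.neg (by
      intro R hR t ht x hx
      simpa using hg R hR t ht x hx) R hR t ht x hx h hh
    linarith
  · exact H u K hK hu hg R hR t ht x hx h hh

lemma liouville {n : ℕ} (hn : 0 < n) {s γ lam Lam K : ℝ} (hs : 0 < s) (hs1 : s < 1)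
    (hγ : 0 < γ) (hγs : γ < 2 * s)
    (hlam : 0 < lam) (hlL : lam ≤ Lam) {a : En n → ℝ} (ha : KernelBounds lam Lam a)
    {u : ℝ → En n → ℝ} (hK : 0 < K) (hu : Sol n s a u) (hg : Gr s γ K u) :
    (∀ t < (0 : ℝ), ∀ x k l : En n, u t (x + k + l) - u t (x + k) - u t (x + l) + u t x = 0) ∧
    (∀ t < (0 : ℝ), ∀ t' < (0 : ℝ), ∀ x, u t x = u t' x) := by
  obtain ⟨ε, hεa, hεb⟩ := exists_between (show γ / 2 < min γ 1 from
    lt_min (by linarith) (by linarith))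
  have hε0 : 0 < ε := by linarith
  have hεγ : ε < γ := lt_of_lt_of_le hεb (min_le_left _ _)
  have hε1 : ε < 1 := lt_of_lt_of_le hεb (min_le_right _ _)
  obtain ⟨M1, hM1, H1⟩ := holder_R hn hs hs1 hγ hγs hε0 hε1 (by linarith) hlam hlL ha
  obtain ⟨M2, hM2, H2⟩ := holder_R hn hs hs1 (show 0 < γ - ε by linarith)
    (show γ - ε < 2 * s by linarith) hε0 hε1 (by linarith) hlam hlL ha
  have hsec : ∀ t < (0 : ℝ), ∀ x k l : En n,
      u t (x + k + l) - u t (x + k) - u t (x + l) + u t x = 0 := by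
    intro t ht x k l
    have hsv : Sol n s a (fun t x => u t (x + k) - u t x) := (hu.shift k).sub hu
    set K2 := M1 * K * (1 + ‖k‖) ^ (γ - ε) * ‖k‖ ^ ε + 1 with hK2
    have hK20 : 0 < K2 := by positivity
    have hgv : Gr s (γ - ε) K2 (fun t x => u t (x + k) - u t x) := by
      intro R hR t ht x hx
      have hk := norm_nonneg k
      have hR0 : 0 < R := by linarith
      have hpow : R ^ (2 * s) ≤ (R + ‖k‖) ^ (2 * s) := by gcongr; linarith
      have h1 := H1 u K hK hu hg (R + ‖k‖) (by linarith) t ⟨by linarith [ht.1], ht.2⟩ x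
        (ball_subset_ball (by linarith) hx) k (by linarith)
      have h2 : (R + ‖k‖) ^ (γ - ε) ≤ (1 + ‖k‖) ^ (γ - ε) * R ^ (γ - ε) := by
        rw [← Real.mul_rpow (by positivity) hR0.le]
        apply Real.rpow_le_rpow (by positivity) (by nlinarith) (by linarith)
      calc |u t (x + k) - u t x| ≤ M1 * K * (R + ‖k‖) ^ (γ - ε) * ‖k‖ ^ ε := h1
        _ ≤ M1 * K * ((1 + ‖k‖) ^ (γ - ε) * R ^ (γ - ε)) * ‖k‖ ^ ε := by gcongr
        _ = (K2 - 1) * R ^ (γ - ε) := by rw [hK2]; ring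
        _ ≤ K2 * R ^ (γ - ε) := by gcongr; linarith
    have hlim : Tendsto (fun R : ℝ => M2 * K2 * R ^ (-(2 * ε - γ)) * ‖l‖ ^ ε) atTop
        (𝓝 (M2 * K2 * 0 * ‖l‖ ^ ε)) :=
      ((tendsto_rpow_neg_atTop (by linarith)).const_mul _).mul_const _
    have hb : |(u t (x + l + k) - u t (x + l)) - (u t (x + k) - u t x)| ≤ M2 * K2 * 0 * ‖l‖ ^ ε := by
      refine ge_of_tendsto hlim ?_
      have e1 : ∀ᶠ R : ℝ in atTop, -t < R ^ (2 * s) :=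
        (tendsto_rpow_atTop (by positivity)).eventually_gt_atTop _
      filter_upwards [e1, eventually_ge_atTop 1, eventually_gt_atTop ‖x‖, eventually_ge_atTop ‖l‖]
        with R h1 h2 h3 h4
      have := H2 _ K2 hK20 hsv hgv R h2 t ⟨by linarith, ht⟩ x (by simpa using h3) l h4
      rw [show γ - ε - ε = -(2 * ε - γ) by ring] at this
      exact this
    rw [mul_zero, zero_mul] at hb
    have := abs_nonpos_iff.1 hb
    rw [show x + k + l = x + l + k by abel]
    linarith
  refine ⟨hsec, ?_⟩
  intro t ht t' ht' x
  have hder : ∀ r < (0 : ℝ), HasDerivAt (fun τ => u τ x) 0 r := by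
    intro r hr
    have h := (hu.solves r hr x).2
    have : Lop n s a (u r) x = 0 := by
      unfold Lop
      have : Lintegrand n s a (u r) x = fun _ => 0 := by
        funext y
        have := hsec r hr (x - y) y y
        rw [sub_add_cancel] at this
        have : u r (x + y) + u r (x - y) - 2 * u r x = 0 := by linarith
        simp [Lintegrand, this]
      rw [this]; simp
    rw [this, add_zero] at h
    exact h
  refine (isOpen_Iio (a := (0 : ℝ))).is_const_of_deriv_eq_zero isPreconnected_Iio
    (fun r hr => (hder r hr).differentiableAt.differentiableWithinAt)
    (fun r hr => (hder r hr).deriv) ht ht'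

lemma additive_expand {n : ℕ} (f : En n → ℝ) (hc : Continuous f)
    (hadd : ∀ x y, f (x + y) = f x + f y) (x : En n) :
    f x = ∑ i, x i * f (EuclideanSpace.single i 1) := by
  have h0 : f 0 = 0 := by
    have := hadd 0 0
    rw [add_zero] at this
    linarith
  set F : En n →+ ℝ := ⟨⟨f, h0⟩, hadd⟩ with hF
  set L := F.toRealLinearMap hc with hL
  have hLf : ∀ y, L y = f y := fun y => rfl
  have hx : x = ∑ i, x i • EuclideanSpace.single i (1 : ℝ) := by
    have := (EuclideanSpace.basisFun (Fin n) ℝ).sum_repr x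
    simpa using this.symm
  conv_lhs => rw [hx]
  rw [← hLf, map_sum]
  refine Finset.sum_congr rfl fun i _ => ?_
  rw [map_smul, hLf, smul_eq_mul]

lemma quad_expand {n : ℕ} (G : En n → ℝ) (hc : Continuous G) (h0 : G 0 = 0)
    (h3 : ∀ h k l : En n, G (h + k + l) - G (h + k) - G (h + l) - G (k + l) + G h + G k + G l = 0) :
    ∃ (p : En n) (A : Matrix (Fin n) (Fin n) ℝ), A.IsSymm ∧
      ∀ x, G x = (∑ i, ∑ j, x i * A i j * x j) + ∑ i, p i * x i := by
  set B : En n → En n → ℝ := fun h k => G (h + k) - G h - G k with hB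
  have hBsymm : ∀ h k, B h k = B k h := by
    intro h k; simp only [hB]; rw [add_comm h k]; ring
  have hBadd : ∀ k h l, B (h + l) k = B h k + B l k := by
    intro k h l
    simp only [hB]
    have := h3 h k l
    rw [show h + l + k = h + k + l by abel, show l + k = k + l by abel]
    linarith
  have hBc : ∀ k, Continuous (fun h => B h k) := by
    intro k; simp only [hB]; fun_prop
  have hB1 : ∀ k x, B x k = ∑ i, x i * B (EuclideanSpace.single i 1) k := fun k x =>
    additive_expand (fun h => B h k) (hBc k) (hBadd k) x
  set P : En n → ℝ := fun x => G x - 1 / 2 * B x x with hP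
  have hPc : Continuous P := by simp only [hP, hB]; fun_prop
  have hPadd : ∀ x y, P (x + y) = P x + P y := by
    intro x y
    have e1 : B (x + y) (x + y) = B x x + 2 * B x y + B y y := by
      rw [hBadd, hBsymm x (x + y), hBsymm y (x + y), hBadd, hBadd, hBsymm y x]; ring
    have e2 : G (x + y) = G x + G y + B x y := by simp only [hB]; ring
    simp only [hP]
    rw [e1, e2]; ring
  have hP1 := additive_expand P hPc hPadd
  refine ⟨WithLp.toLp 2 (fun i => P (EuclideanSpace.single i 1)),
    Matrix.of fun i j => 1 / 2 * B (EuclideanSpace.single i 1) (EuclideanSpace.single j 1), ?_, ?_⟩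
  · ext i j
    simp only [Matrix.transpose_apply, Matrix.of_apply]
    rw [hBsymm]
  · intro x
    have e : G x = 1 / 2 * B x x + P x := by simp only [hP]; ring
    rw [e, hP1 x, hB1 x x, Finset.mul_sum]
    congr 1
    · refine Finset.sum_congr rfl fun i _ => ?_
      rw [hBsymm, hB1, Finset.mul_sum, Finset.mul_sum]
      refine Finset.sum_congr rfl fun j _ => ?_
      rw [Matrix.of_apply, hBsymm (EuclideanSpace.single j 1)]
      ring
    · refine Finset.sum_congr rfl fun i _ => ?_
      simp only
      ring

lemma time_linear (T : ℝ → ℝ) (hc : ContinuousOn T (Iio 0))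
    (h : ∀ τ < (0 : ℝ), ∀ t < (0 : ℝ), ∀ t' < (0 : ℝ), T (t + τ) - T t = T (t' + τ) - T t') :
    ∃ c q : ℝ, ∀ t < (0 : ℝ), T t = c * t + q := by
  set S : ℝ → ℝ := fun r => T (-1 - r) - T (-1) with hS
  have hSadd : ∀ r r' : ℝ, 0 ≤ r → 0 ≤ r' → S (r + r') = S r + S r' := by
    intro r r' hr hr'
    rcases eq_or_lt_of_le hr' with h0 | h0
    · simp [hS, ← h0]
    · have := h (-r') (by linarith) (-1 - r) (by linarith) (-1) (by norm_num)
      simp only [hS]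
      rw [show -1 - (r + r') = -1 - r + -r' by ring, show -1 - r' = -1 + -r' by ring]
      linarith
  set Z : ℝ → ℝ := fun r => S (max r 0) - S (max (-r) 0) with hZ
  have hScont : ContinuousOn S (Ici 0) := by
    refine ContinuousOn.sub ?_ continuousOn_const
    refine hc.comp (by fun_prop) (fun r hr => ?_)
    have : (0 : ℝ) ≤ r := hr
    simp only [mem_Iio]; linarith
  have hZc : Continuous Z := by
    refine Continuous.sub ?_ ?_
    · exact hScont.comp_continuous (by fun_prop) (fun r => mem_Ici.2 (le_max_right _ _))
    · exact hScont.comp_continuous (by fun_prop) (fun r => mem_Ici.2 (le_max_right _ _))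
  have hdec : ∀ r : ℝ, max r 0 = r + max (-r) 0 := by
    intro r
    rcases le_total r 0 with h | h
    · rw [max_eq_right h, max_eq_left (by linarith)]; ring
    · rw [max_eq_left h, max_eq_right (by linarith)]; ring
  have hZadd : ∀ r r', Z (r + r') = Z r + Z r' := by
    intro r r'
    have n1 : ∀ r : ℝ, 0 ≤ max r 0 := fun r => le_max_right _ _
    have e : max (r + r') 0 + (max (-r) 0 + max (-r') 0) =
        max (-(r + r')) 0 + (max r 0 + max r' 0) := by
      have := hdec r
      have := hdec r'
      have := hdec (r + r')
      linarith
    have e2 := congrArg S e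
    rw [hSadd _ _ (n1 _) (add_nonneg (n1 _) (n1 _)), hSadd _ _ (n1 _) (add_nonneg (n1 _) (n1 _)),
      hSadd _ _ (n1 _) (n1 _), hSadd _ _ (n1 _) (n1 _)] at e2
    simp only [hZ]
    linarith
  have hZ0 : Z 0 = 0 := by simp [hZ]
  set F : ℝ →+ ℝ := ⟨⟨Z, hZ0⟩, hZadd⟩ with hF
  have hlin : ∀ r, Z r = r * Z 1 := by
    intro r
    have h1 := (F.toRealLinearMap hZc).map_smul r 1
    have h2 : ∀ y, F.toRealLinearMap hZc y = Z y := fun y => rfl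
    rw [h2, h2] at h1
    simpa using h1
  have hS1 : ∀ r, 0 ≤ r → S r = r * Z 1 := by
    intro r hr
    rw [← hlin r]
    simp only [hZ]
    rw [max_eq_left hr, max_eq_right (by linarith)]
    have : S 0 = 0 := by simp [hS]
    rw [this, sub_zero]
  refine ⟨-Z 1, T (-1) - Z 1, fun t ht => ?_⟩
  have h1 := h (-1) (by norm_num) t ht (-1) (by norm_num)
  have h2 := hS1 (-t) (by linarith)
  have h3 := hS1 1 (by norm_num)
  simp only [hS] at h2 h3
  rw [show -1 - -t = t + -1 by ring] at h2
  rw [show (-1 : ℝ) - 1 = -1 + -1 by ring] at h3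
  linarith

lemma growth_zero {κ μ ν D : ℝ} (hνμ : ν < μ) (h : ∀ R ≥ (1 : ℝ), |κ| * R ^ μ ≤ D * R ^ ν) :
    κ = 0 := by
  have hlim : Tendsto (fun R : ℝ => D * R ^ (-(μ - ν))) atTop (𝓝 (D * 0)) :=
    (tendsto_rpow_neg_atTop (by linarith)).const_mul _
  have hb : |κ| ≤ D * 0 := by
    refine ge_of_tendsto hlim ?_
    filter_upwards [eventually_ge_atTop 1] with R hR
    have hR0 : 0 < R := by linarith
    have h1 := h R hR
    rw [show -(μ - ν) = ν - μ by ring, Real.rpow_sub hR0, ← mul_div_assoc, le_div_iff₀ (by positivity)]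
    exact h1
  rw [mul_zero] at hb
  exact abs_nonpos_iff.1 hb

lemma quad_zero {n : ℕ} (A : Matrix (Fin n) (Fin n) ℝ) (hA : A.IsSymm)
    (h : ∀ x : En n, (∑ i, ∑ j, x i * A i j * x j) = 0) : A = 0 := by
  have key : ∀ a b, A a a + A a b + A b a + A b b = 0 := by
    intro a b
    have := h (EuclideanSpace.single a 1 + EuclideanSpace.single b 1)
    simp [add_mul, mul_add, Finset.sum_add_distrib, Pi.single_apply] at this
    linarith
  ext a b
  have h1 := key a a
  have h2 := key b b
  have h3 := key a b
  have h4 : A b a = A a b := hA.apply a b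
  simp only [Matrix.zero_apply]
  linarith

lemma w_continuous {n : ℕ} {s β α C : ℝ} (hs : 0 < s) (hβ : 0 < β) {w : ℝ → En n → ℝ}
    (hgrowth : ∀ R ≥ (1 : ℝ),
      ParHolderBnd s β (C * R ^ (α + s)) (Ioo (-(R ^ (2 * s))) 0) (ball (0 : En n) R) w) :
    ContinuousOn (fun z : ℝ × En n => w z.1 z.2) (Iio 0 ×ˢ univ) := by
  rintro ⟨t, x⟩ ⟨ht, -⟩
  have ht : t < 0 := ht
  apply ContinuousAt.continuousWithinAt
  have e1 : ∀ᶠ R : ℝ in atTop, -t < R ^ (2 * s) :=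
    (tendsto_rpow_atTop (by positivity)).eventually_gt_atTop _
  obtain ⟨R, h1, h2, h3⟩ := (e1.and ((eventually_ge_atTop 1).and (eventually_gt_atTop ‖x‖))).exists
  have hmem : Ioo (-(R ^ (2 * s))) 0 ×ˢ ball (0 : En n) R ∈ 𝓝 (t, x) :=
    (isOpen_Ioo.prod isOpen_ball).mem_nhds ⟨⟨by linarith, ht⟩, by simpa using h3⟩
  unfold ContinuousAt
  rw [tendsto_iff_dist_tendsto_zero]
  have hlim : Tendsto (fun z : ℝ × En n => C * R ^ (α + s) *
      (|z.1 - t| ^ (β / (2 * s)) + ‖z.2 - x‖ ^ β)) (𝓝 (t, x)) (𝓝 0) := by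
    have hc : Continuous (fun z : ℝ × En n => C * R ^ (α + s) *
      (|z.1 - t| ^ (β / (2 * s)) + ‖z.2 - x‖ ^ β)) := by
      refine continuous_const.mul (Continuous.add ?_ ?_)
      · exact Continuous.rpow_const (by fun_prop) (fun _ => Or.inr (by positivity))
      · exact Continuous.rpow_const (by fun_prop) (fun _ => Or.inr hβ.le)
    have := hc.tendsto (t, x)
    simpa [Real.zero_rpow hβ.ne', Real.zero_rpow (show β / (2 * s) ≠ 0 by positivity)] using this
  refine squeeze_zero' (Eventually.of_forall fun _ => dist_nonneg) ?_ hlim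
  filter_upwards [hmem] with z hz
  exact hgrowth R h2 z.1 hz.1 z.2 hz.2 t ⟨by linarith, ht⟩ x (by simpa using h3)

lemma increment_growth {n : ℕ} {s β α C : ℝ} (hs : 0 < s) (hα : 0 < α) (hC : 0 < C)
    {w : ℝ → En n → ℝ}
    (hgrowth : ∀ R ≥ (1 : ℝ),
      ParHolderBnd s β (C * R ^ (α + s)) (Ioo (-(R ^ (2 * s))) 0) (ball (0 : En n) R) w)
    (h : En n) {τ : ℝ} (hτ : τ < 0) :
    ∃ K > (0 : ℝ), Gr s (α + s) K (fun t x => w (t + τ) (x + h) - w t x) := by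
  set c : ℝ := (1 + ‖h‖) * (1 + |τ|) ^ (1 / (2 * s)) with hc
  have hh := norm_nonneg h
  have hτ0 := abs_nonneg τ
  have hd1 : 1 ≤ (1 + |τ|) ^ (1 / (2 * s)) := Real.one_le_rpow (by linarith) (by positivity)
  have hch : 1 + ‖h‖ ≤ c := le_mul_of_one_le_right (by positivity) hd1
  have hcs : 1 + |τ| ≤ c ^ (2 * s) := by
    rw [hc, Real.mul_rpow (by positivity) (by positivity), ← Real.rpow_mul (by positivity),
      one_div, inv_mul_cancel₀ (by positivity), Real.rpow_one]
    exact le_mul_of_one_le_left (by positivity) (Real.one_le_rpow (by linarith) (by positivity))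
  refine ⟨C * c ^ (α + s) * (|τ| ^ (β / (2 * s)) + ‖h‖ ^ β), ?_, ?_⟩
  · have : 0 < |τ| := abs_pos.2 hτ.ne
    have : 0 < c := by linarith
    positivity
  · intro R hR t ht x hx
    have hR0 : 0 < R := by linarith
    have hc0 : 0 < c := by linarith
    have hxn : ‖x‖ < R := by simpa using hx
    have hRs : 1 ≤ R ^ (2 * s) := Real.one_le_rpow hR (by positivity)
    have hpow : R ^ (2 * s) + |τ| ≤ (c * R) ^ (2 * s) := by
      rw [Real.mul_rpow hc0.le hR0.le]
      nlinarith
    have hτa : |τ| = -τ := abs_of_neg hτ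
    have hRc : R * (1 + ‖h‖) ≤ c * R := by nlinarith
    have h1 := hgrowth (c * R) (by nlinarith) (t + τ) ⟨by linarith [ht.1], by linarith [ht.2]⟩ (x + h)
      (by
        simp only [mem_ball, dist_zero_right]
        have := norm_add_le x h
        nlinarith) t ⟨by linarith [ht.1], ht.2⟩ x (by
        simp only [mem_ball, dist_zero_right]
        nlinarith)
    rw [add_sub_cancel_left, add_sub_cancel_left, Real.mul_rpow hc0.le hR0.le] at h1
    refine h1.trans (le_of_eq ?_)
    ring

/-- Lemma 5.1: Liouville-type theorem in the whole space. -/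
theorem stmt_8
    (n : ℕ) (s β α lam Lam : ℝ)
    (hn : 0 < n) (hs : s ∈ Ioo (0 : ℝ) 1) (hβ : β ∈ Ioo (0 : ℝ) 1) (hα : α ∈ Ioo 0 s)
    (hαβ : α + β < 2 * s)
    (hlam : 0 < lam) (hlL : lam ≤ Lam)
    (a : En n → ℝ) (ha : KernelBounds lam Lam a)
    (w : ℝ → En n → ℝ) (C : ℝ) (hC : 0 < C)
    -- `(∂_t - L)(w(·+τ,·+h) - w) = 0` in `(-∞,0) × ℝ^n` for all `h ∈ ℝ^n`, `τ < 0`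
    (heq : ∀ h : En n, ∀ τ < (0 : ℝ), ∀ t < (0 : ℝ), ∀ x : En n,
      SolvesAt n s a (fun t' x' => w (t' + τ) (x' + h) - w t' x') (fun _ _ => 0) t x)
    -- growth control `[w]_{C^{β/2s,β}(Q_R)} ≤ C R^{α+s}`
    (hgrowth : ∀ R ≥ (1 : ℝ),
      ParHolderBnd s β (C * R ^ (α + s)) (Ioo (-(R ^ (2 * s))) 0) (ball (0 : En n) R) w) :
    ∃ (c q : ℝ) (p : En n) (A : Matrix (Fin n) (Fin n) ℝ),
      A.IsSymm ∧
      (∀ t < (0 : ℝ), ∀ x : En n,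
        w t x = c * t + (∑ i, ∑ j, x i * A i j * x j) + (∑ i, p i * x i) + q) ∧
      (α + β < s → c = 0) ∧ (α + β + s < 2 → A = 0) ∧ (α + β + s < 1 → p = 0) := by
  obtain ⟨hs0, hs1⟩ := hs
  obtain ⟨hβ0, hβ1⟩ := hβ
  obtain ⟨hα0, hαs⟩ := hα
  have hwc := w_continuous hs0 hβ0 hgrowth
  -- Liouville for all increments
  have hL : ∀ h : En n, ∀ τ < (0 : ℝ),
      (∀ t < (0 : ℝ), ∀ x k l : En n,
        (w (t + τ) (x + k + l + h) - w t (x + k + l)) - (w (t + τ) (x + k + h) - w t (x + k))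
          - (w (t + τ) (x + l + h) - w t (x + l)) + (w (t + τ) (x + h) - w t x) = 0) ∧
      (∀ t < (0 : ℝ), ∀ t' < (0 : ℝ), ∀ x,
        w (t + τ) (x + h) - w t x = w (t' + τ) (x + h) - w t' x) := by
    intro h τ hτ
    obtain ⟨K, hK, hGr⟩ := increment_growth hs0 hα0 hC hgrowth h hτ
    have hSol : Sol n s a (fun t x => w (t + τ) (x + h) - w t x) := by
      refine ⟨ContinuousOn.sub ?_ hwc, fun t ht x => heq h τ hτ t ht x⟩
      refine hwc.comp (f := fun z : ℝ × En n => (z.1 + τ, z.2 + h)) (by fun_prop) ?_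
      intro z hz
      have : z.1 < 0 := hz.1
      exact ⟨mem_Iio.2 (by linarith), mem_univ _⟩
    exact liouville hn hs0 hs1 (by linarith) (by linarith) hlam hlL ha hK hSol hGr
  -- separation of variables
  have hsep : ∀ t < (0 : ℝ), ∀ t' < (0 : ℝ), ∀ x, w t x - w t 0 = w t' x - w t' 0 := by
    intro t ht t' ht' x
    have h1 := (hL x (-1) (by norm_num)).2 t ht t' ht' 0
    have h2 := (hL 0 (-1) (by norm_num)).2 t ht t' ht' x
    rw [zero_add] at h1
    rw [add_zero] at h2
    linarith
  have hwx : ∀ t < (0 : ℝ), Continuous (w t) := by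
    intro t ht
    have := hwc.comp (f := fun x : En n => (t, x)) (s := univ) (by fun_prop)
      (fun x _ => ⟨ht, mem_univ _⟩)
    exact continuousOn_univ.1 this
  have hm1 : (-1 : ℝ) < 0 := by norm_num
  obtain ⟨c, q, hT⟩ := time_linear (fun t => w t 0)
    (hwc.comp (f := fun t : ℝ => (t, (0 : En n))) (by fun_prop) (fun t ht => ⟨ht, mem_univ _⟩))
    (by
      intro τ hτ t ht t' ht'
      have := (hL 0 τ hτ).2 t ht t' ht' 0
      simpa using this)
  obtain ⟨p, A, hA, hG⟩ := quad_expand (fun x => w (-1) x - w (-1) 0)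
    ((hwx _ hm1).sub continuous_const) (by simp) (by
      intro h k l
      have h1 := (hL h (-1) hm1).1 (-1) hm1 0 k l
      have hs2 : ∀ x, w (-1 + -1) x = w (-1 + -1) 0 + (w (-1) x - w (-1) 0) := by
        intro x
        have := hsep (-1 + -1) (by norm_num) (-1) hm1 x
        linarith
      simp only [zero_add] at h1
      rw [hs2 (k + l + h), hs2 (k + h), hs2 (l + h), hs2 h] at h1
      rw [show h + k + l = k + l + h by abel, add_comm h k, add_comm h l]
      linarith)
  have hform : ∀ t < (0 : ℝ), ∀ x : En n,
      w t x = c * t + (∑ i, ∑ j, x i * A i j * x j) + (∑ i, p i * x i) + q := by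
    intro t ht x
    have h1 := hsep t ht (-1) hm1 x
    have h2 := hT t ht
    have h3 := hG x
    simp only at h2 h3
    linarith
  -- growth in space
  have hspace : ∀ e : En n, ∀ R ≥ (1 : ℝ),
      |R ^ 2 * (∑ i, ∑ j, e i * A i j * e j) + R * (∑ i, p i * e i)| ≤
        (C * (1 + ‖e‖) ^ (α + β + s)) * R ^ (α + β + s) := by
    intro e R hR
    have hR0 : 0 < R := by linarith
    have he := norm_nonneg e
    set R' := (1 + ‖e‖) * R with hR'
    have hR'1 : 1 ≤ R' := by nlinarith
    have hR'0 : 0 < R' := by linarith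
    have hRs : 1 ≤ R' ^ (2 * s) := Real.one_le_rpow hR'1 (by positivity)
    have hnorm : ‖R • e‖ < R' := by
      rw [norm_smul, Real.norm_of_nonneg hR0.le]; nlinarith
    have h1 := hgrowth R' hR'1 (-1 / 2) ⟨by linarith, by norm_num⟩ (R • e) (by simpa using hnorm)
      (-1 / 2) ⟨by linarith, by norm_num⟩ 0 (by simpa using hR'0)
    rw [hform _ (by norm_num), hform _ (by norm_num)] at h1
    have e1 : (∑ i, ∑ j, (R • e) i * A i j * (R • e) j) = R ^ 2 * ∑ i, ∑ j, e i * A i j * e j := by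
      simp only [Finset.mul_sum, PiLp.smul_apply, smul_eq_mul]
      refine Finset.sum_congr rfl fun i _ => Finset.sum_congr rfl fun j _ => ?_
      ring
    have e2 : (∑ i, p i * (R • e) i) = R * ∑ i, p i * e i := by
      simp only [Finset.mul_sum, PiLp.smul_apply, smul_eq_mul]
      refine Finset.sum_congr rfl fun i _ => ?_
      ring
    rw [e1, e2] at h1
    simp only [PiLp.zero_apply, zero_mul, mul_zero, Finset.sum_const_zero, sub_self, abs_zero,
      sub_zero, add_zero, add_sub_add_right_eq_sub, Real.zero_rpow (show β / (2 * s) ≠ 0 by positivity),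
      zero_add] at h1
    have h2 : ‖R • e‖ ^ β ≤ R' ^ β := Real.rpow_le_rpow (norm_nonneg _) hnorm.le hβ0.le
    calc |R ^ 2 * (∑ i, ∑ j, e i * A i j * e j) + R * (∑ i, p i * e i)|
        ≤ C * R' ^ (α + s) * ‖R • e‖ ^ β := by
          refine le_trans (le_of_eq ?_) h1
          congr 1; ring
      _ ≤ C * R' ^ (α + s) * R' ^ β := by gcongr
      _ = C * R' ^ (α + β + s) := by
          rw [mul_assoc, ← Real.rpow_add hR'0]; congr 2; ring
      _ = _ := by rw [hR', Real.mul_rpow (by positivity) hR0.le]; ring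
  have hAzero : α + β + s < 2 → A = 0 := by
    intro hlt
    refine quad_zero A hA fun e => ?_
    refine growth_zero (D := C * (1 + ‖e‖) ^ (α + β + s)) hlt fun R hR => ?_
    have h1 := hspace e R hR
    have h2 := hspace (-e) R hR
    have e1 : (∑ i, ∑ j, (-e) i * A i j * (-e) j) = ∑ i, ∑ j, e i * A i j * e j := by
      simp
    have e2 : (∑ i, p i * (-e) i) = - ∑ i, p i * e i := by simp
    rw [e1, e2, norm_neg] at h2
    have e3 : |∑ i, ∑ j, e i * A i j * e j| * R ^ (2 : ℝ) = |R ^ 2 * ∑ i, ∑ j, e i * A i j * e j| := by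
      rw [abs_mul, abs_of_nonneg (sq_nonneg R), mul_comm]; norm_cast
    rw [e3]
    rw [abs_le] at h1 h2 ⊢
    constructor <;> linarith [h1.1, h1.2, h2.1, h2.2]
  refine ⟨c, q, p, A, hA, hform, ?_, hAzero, ?_⟩
  · intro hlt
    refine growth_zero (μ := 2 * s) (ν := α + β + s) (D := 4 * C) (by linarith) fun R hR => ?_
    have hR0 : 0 < R := by linarith
    have hRs : 0 < R ^ (2 * s) := by positivity
    have h1 := hgrowth R hR (-(R ^ (2 * s)) / 4) ⟨by linarith, by linarith⟩ 0 (by simpa using hR0)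
      (-(R ^ (2 * s)) / 2) ⟨by linarith, by linarith⟩ 0 (by simpa using hR0)
    rw [hform _ (by linarith), hform _ (by linarith)] at h1
    have e1 : -(R ^ (2 * s)) / 4 - -(R ^ (2 * s)) / 2 = R ^ (2 * s) / 4 := by ring
    simp only [add_sub_add_right_eq_sub, ← mul_sub, e1, sub_self, norm_zero,
      Real.zero_rpow hβ0.ne', add_zero] at h1
    rw [abs_mul, abs_of_pos (show 0 < R ^ (2 * s) / 4 by positivity)] at h1
    have h2 : (R ^ (2 * s) / 4) ^ (β / (2 * s)) ≤ R ^ β := by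
      calc (R ^ (2 * s) / 4) ^ (β / (2 * s)) ≤ (R ^ (2 * s)) ^ (β / (2 * s)) :=
            Real.rpow_le_rpow (by positivity) (by linarith) (by positivity)
        _ = R ^ β := by
            rw [← Real.rpow_mul hR0.le]; congr 1; field_simp
    have h3 : C * R ^ (α + s) * (R ^ (2 * s) / 4) ^ (β / (2 * s)) ≤ C * R ^ (α + β + s) := by
      calc _ ≤ C * R ^ (α + s) * R ^ β := by gcongr
        _ = _ := by rw [mul_assoc, ← Real.rpow_add hR0]; congr 2; ring
    linarith
  · intro hlt
    have hA0 := hAzero (by linarith)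
    have hp : ∀ e : En n, (∑ i, p i * e i) = 0 := by
      intro e
      refine growth_zero (D := C * (1 + ‖e‖) ^ (α + β + s)) hlt fun R hR => ?_
      have h1 := hspace e R hR
      simp only [hA0, Matrix.zero_apply, mul_zero, zero_mul, Finset.sum_const_zero, zero_add] at h1
      rw [abs_mul, abs_of_pos (show 0 < R by linarith)] at h1
      rw [Real.rpow_one, mul_comm]
      exact h1
    ext i
    have := hp (EuclideanSpace.single i 1)
    simpa [Pi.single_apply] using this
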